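/- arXiv:1908.11045 — 4 statements merged into one kernel-verified Lean document; each statement's English description precedes it below -/
import Mathlib

section
/- Let Γ = S_k be the symmetric group on k letters with k ≥ 5, and for n ≥ 3 let G_n = Γ^n ⋊ S_n and K_n = Δ_n × S_n. Then (G_n, K_n) is not a Gelfand pair; that is, the convolution algebra of K_n-bi-invariant complex-valued functions on G_n is not commutative. -/
noncomputable section

/-- The action of `Equiv.Perm (Fin n)` on `Fin n → Γ` permuting the factors. -/
def permHom (Γ : Type) [Group Γ] (n : ℕ) : Equiv.Perm (Fin n) →* MulAut (Fin n → Γ) where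
  toFun σ :=
    { toFun := fun f => f ∘ σ.symm
      invFun := fun f => f ∘ σ
      left_inv := fun f => by ext i; simp
      right_inv := fun f => by ext i; simp
      map_mul' := fun f g => rfl }
  map_one' := by ext f i; rfl
  map_mul' := fun σ τ => by ext f i; rfl

/-- The wreath product `Γ^n ⋊ S_n`. -/
abbrev Gn (Γ : Type) [Group Γ] (n : ℕ) := (Fin n → Γ) ⋊[permHom Γ n] Equiv.Perm (Fin n)

/-- The subgroup `K_n = Δ_n × S_n` of `G_n`, where `Δ_n` is the diagonal subgroup of `Γ^n`. -/
def Kn (Γ : Type) [Group Γ] (n : ℕ) : Subgroup (Gn Γ n) where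
  carrier := {g | ∃ γ : Γ, g.left = fun _ => γ}
  one_mem' := ⟨1, rfl⟩
  mul_mem' := by
    rintro a b ⟨γ, ha⟩ ⟨δ, hb⟩
    exact ⟨γ * δ, by simp [SemidirectProduct.mul_left, ha, hb, permHom]; rfl⟩
  inv_mem' := by
    rintro a ⟨γ, ha⟩
    exact ⟨γ⁻¹, by simp [SemidirectProduct.inv_left, ha, permHom]; rfl⟩

instance {N G : Type*} [Group N] [Group G] {φ : G →* MulAut N} [Fintype N] [Fintype G] :
    Fintype (N ⋊[φ] G) :=
  Fintype.ofEquiv (N × G)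
    { toFun := fun p => ⟨p.1, p.2⟩
      invFun := fun s => (s.left, s.right)
      left_inv := fun p => rfl
      right_inv := fun s => rfl }

/-- Convolution product on complex-valued functions on a finite group. -/
def conv {G : Type*} [Group G] [Fintype G] (f g : G → ℂ) : G → ℂ :=
  fun x => (Fintype.card G : ℂ)⁻¹ * ∑ y : G, f (x * y⁻¹) * g y

/-- A function on `G` is `K`-bi-invariant. -/
def IsBiinvariant {G : Type*} [Group G] (K : Subgroup G) (f : G → ℂ) : Prop :=
  ∀ k₁ ∈ K, ∀ k₂ ∈ K, ∀ x : G, f (k₁ * x * k₂) = f x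

/-- `(G, K)` is a Gelfand pair if the convolution algebra of `K`-bi-invariant
complex-valued functions on `G` is commutative. -/
def IsGelfandPair (G : Type*) [Group G] [Fintype G] (K : Subgroup G) : Prop :=
  ∀ f g : G → ℂ, IsBiinvariant K f → IsBiinvariant K g → conv f g = conv g f


/-- The support of a convolution of indicator functions of two double cosets does not depend on
the order of the factors when `(G, K)` is a Gelfand pair. -/
lemma IsGelfandPair.exists_mul_eq {G : Type*} [Group G] [Fintype G] {K : Subgroup G}
    (h : IsGelfandPair G K) (a b : G) :
    ∃ k₁ ∈ K, ∃ k₂ ∈ K, ∃ k₃ ∈ K, a * b = k₁ * b * k₂ * a * k₃ := by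
  classical
  let F : G → G → ℂ := fun c x => if ∃ k₁ ∈ K, ∃ k₂ ∈ K, x = k₁ * c * k₂ then 1 else 0
  have hF : ∀ c, IsBiinvariant K (F c) := by
    intro c k₁ h₁ k₂ h₂ x
    have : (∃ l₁ ∈ K, ∃ l₂ ∈ K, k₁ * x * k₂ = l₁ * c * l₂) ↔
        ∃ l₁ ∈ K, ∃ l₂ ∈ K, x = l₁ * c * l₂ := by
      constructor
      · rintro ⟨l₁, m₁, l₂, m₂, e⟩
        refine ⟨k₁⁻¹ * l₁, K.mul_mem (K.inv_mem h₁) m₁, l₂ * k₂⁻¹,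
          K.mul_mem m₂ (K.inv_mem h₂), ?_⟩
        have : x = k₁⁻¹ * (k₁ * x * k₂) * k₂⁻¹ := by group
        rw [this, e]; group
      · rintro ⟨l₁, m₁, l₂, m₂, rfl⟩
        exact ⟨k₁ * l₁, K.mul_mem h₁ m₁, l₂ * k₂, K.mul_mem m₂ h₂, by group⟩
    simp only [F, this]
  by_contra hne
  have h0 : conv (F b) (F a) (a * b) = 0 := by
    simp only [conv]
    rw [Finset.sum_eq_zero, mul_zero]
    intro y _
    by_contra hy
    obtain ⟨hy₁, hy₂⟩ := mul_ne_zero_iff.1 hy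
    obtain ⟨k₁, m₁, k₂, m₂, e₁⟩ : ∃ k₁ ∈ K, ∃ k₂ ∈ K, a * b * y⁻¹ = k₁ * b * k₂ := by
      by_contra hc; exact hy₁ (if_neg hc)
    obtain ⟨l₁, n₁, l₂, n₂, e₂⟩ : ∃ k₁ ∈ K, ∃ k₂ ∈ K, y = k₁ * a * k₂ := by
      by_contra hc; exact hy₂ (if_neg hc)
    refine hne ⟨k₁, m₁, k₂ * l₁, K.mul_mem m₂ n₁, l₂, n₂, ?_⟩
    calc a * b = a * b * y⁻¹ * y := by group
      _ = k₁ * b * (k₂ * l₁) * a * l₂ := by rw [e₁, e₂]; group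
  have h1 : conv (F a) (F b) (a * b) ≠ 0 := by
    have hind : ∀ y, F a (a * b * y⁻¹) * F b y =
        ((if (∃ k₁ ∈ K, ∃ k₂ ∈ K, a * b * y⁻¹ = k₁ * a * k₂) ∧
          ∃ k₁ ∈ K, ∃ k₂ ∈ K, y = k₁ * b * k₂ then 1 else 0 : ℕ) : ℂ) := by
      intro y
      simp only [F, ite_and]
      split_ifs <;> simp
    simp only [conv, hind]
    rw [← Nat.cast_sum]
    refine mul_ne_zero (by simp) (Nat.cast_ne_zero.2 ?_)
    rw [Ne, Finset.sum_eq_zero_iff]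
    intro hzero
    refine absurd (hzero b (Finset.mem_univ _)) ?_
    rw [if_pos ⟨⟨1, K.one_mem, 1, K.one_mem, by group⟩, ⟨1, K.one_mem, 1, K.one_mem, by group⟩⟩]
    exact one_ne_zero
  exact h1 (by rw [h _ _ (hF a) (hF b), h0])

section Swaps

open Equiv

variable {α : Type*} [DecidableEq α]

/-- The product of the transpositions listed in `L`. -/
def swapProd (L : List (α × α)) : Perm α := (L.map fun p => swap p.1 p.2).prod

lemma swapProd_append (L M : List (α × α)) : swapProd (L ++ M) = swapProd L * swapProd M := by
  simp [swapProd]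

lemma swapProd_map (g : Perm α) (L : List (α × α)) :
    swapProd (L.map fun p => (g p.1, g p.2)) = g * swapProd L * g⁻¹ := by
  induction L with
  | nil => simp [swapProd]
  | cons p L ih =>
    simp only [swapProd, List.map_cons, List.prod_cons] at ih ⊢
    rw [ih, swap_apply_apply]
    group

/-- The permutation `π` is a product of at most `m` transpositions. -/
def IsSwapProd (m : ℕ) (π : Perm α) : Prop := ∃ L : List (α × α), L.length ≤ m ∧ swapProd L = π

lemma IsSwapProd.mul {m l : ℕ} {π ρ : Perm α} (h : IsSwapProd m π) (h' : IsSwapProd l ρ) :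
    IsSwapProd (m + l) (π * ρ) := by
  obtain ⟨L, hL, rfl⟩ := h
  obtain ⟨M, hM, rfl⟩ := h'
  exact ⟨L ++ M, by simp; omega, swapProd_append L M⟩

lemma IsSwapProd.conj {m : ℕ} {π : Perm α} (h : IsSwapProd m π) (g : Perm α) :
    IsSwapProd m (g * π * g⁻¹) := by
  obtain ⟨L, hL, rfl⟩ := h
  exact ⟨L.map fun p => (g p.1, g p.2), by simpa using hL, swapProd_map g L⟩

lemma single_swapProd_sub_mem (L : List (α × α)) (U : Submodule ℚ (α → ℚ))
    (hU : ∀ p ∈ L, (Pi.single p.1 1 - Pi.single p.2 1 : α → ℚ) ∈ U) (x : α) :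
    (Pi.single (swapProd L x) 1 - Pi.single x 1 : α → ℚ) ∈ U := by
  induction L with
  | nil => simp [swapProd]
  | cons p L ih =>
    have ih := ih fun q hq => hU q (List.mem_cons_of_mem _ hq)
    have hp := hU p List.mem_cons_self
    have e : swapProd (p :: L) x = swap p.1 p.2 (swapProd L x) := by simp [swapProd]
    rw [e]
    rcases eq_or_ne (swapProd L x) p.1 with h | h
    · rw [h, swap_apply_left]
      rw [h] at ih
      simpa using U.sub_mem ih hp
    rcases eq_or_ne (swapProd L x) p.2 with h' | h'
    · rw [h', swap_apply_right]
      rw [h'] at ih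
      simpa using U.add_mem hp ih
    · rwa [swap_apply_of_ne_of_ne h h']

variable {r : ℕ} (f : Fin (r + 1) → α) (L : List (α × α))

/-- The span of `f 0` and the differences of the pairs in `L`. -/
def swapSpan : Submodule ℚ (α → ℚ) :=
  Submodule.span ℚ
    {v | v ∈ Pi.single (f 0) 1 :: L.map fun p => (Pi.single p.1 1 - Pi.single p.2 1 : α → ℚ)}

lemma sub_mem_swapSpan {p : α × α} (hp : p ∈ L) :
    (Pi.single p.1 1 - Pi.single p.2 1 : α → ℚ) ∈ swapSpan f L := by
  refine Submodule.subset_span ?_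
  simp only [Set.mem_ofPred_eq, List.mem_cons, List.mem_map]
  exact Or.inr ⟨p, hp, rfl⟩

lemma finrank_swapSpan_le : Module.finrank ℚ (swapSpan f L) ≤ L.length + 1 := by
  classical
  rw [swapSpan, ← List.coe_toFinset]
  refine (finrank_span_finset_le_card _).trans ((List.toFinset_card_le _).trans ?_)
  simp

variable {f L}

lemma single_mem_swapSpan (h : ∀ i : Fin r, swapProd L (f i.castSucc) = f i.succ)
    (i : Fin (r + 1)) : (Pi.single (f i) 1 : α → ℚ) ∈ swapSpan f L := by
  induction i using Fin.induction with
  | zero => exact Submodule.subset_span (by simp)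
  | succ i ih =>
    have := single_swapProd_sub_mem L _ (fun p hp => sub_mem_swapSpan f L hp) (f i.castSucc)
    rw [h] at this
    simpa using (swapSpan f L).add_mem this ih

lemma finrank_span_single [Fintype α] (hf : Function.Injective f) :
    Module.finrank ℚ (Submodule.span ℚ (Set.range fun i => (Pi.single (f i) 1 : α → ℚ))) =
      r + 1 := by
  have hli : LinearIndependent ℚ fun i => (Pi.single (f i) 1 : α → ℚ) := by
    have := (Pi.basisFun ℚ α).linearIndependent.comp f hf
    convert this using 2
    simp
  rw [finrank_span_eq_card hli, Fintype.card_fin]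

lemma span_single_le_swapSpan (h : ∀ i : Fin r, swapProd L (f i.castSucc) = f i.succ) :
    Submodule.span ℚ (Set.range fun i => (Pi.single (f i) 1 : α → ℚ)) ≤ swapSpan f L := by
  rw [Submodule.span_le]
  rintro _ ⟨i, rfl⟩
  exact single_mem_swapSpan h i

/-- A cycle through `r + 1` letters needs at least `r` transpositions. -/
lemma le_length_of_swapProd [Fintype α] (hf : Function.Injective f)
    (h : ∀ i : Fin r, swapProd L (f i.castSucc) = f i.succ) : r ≤ L.length := by
  have h₁ := Submodule.finrank_mono (span_single_le_swapSpan h)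
  rw [finrank_span_single hf] at h₁
  have := finrank_swapSpan_le f L
  omega

/-- If a product of `r` transpositions cycles through `r + 1` letters, then all the transpositions
only involve these letters. -/
lemma mem_range_of_swapProd [Fintype α] (hf : Function.Injective f)
    (h : ∀ i : Fin r, swapProd L (f i.castSucc) = f i.succ) (hL : L.length ≤ r)
    {p : α × α} (hp : p ∈ L) (hne : p.1 ≠ p.2) : p.1 ∈ Set.range f ∧ p.2 ∈ Set.range f := by
  have hU : Submodule.span ℚ (Set.range fun i => (Pi.single (f i) 1 : α → ℚ)) = swapSpan f L := by
    refine Submodule.eq_of_le_of_finrank_le (span_single_le_swapSpan h) ?_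
    rw [finrank_span_single hf]
    exact (finrank_swapSpan_le f L).trans (by omega)
  have key : ∀ x ∉ Set.range f, ∀ v ∈ swapSpan f L, v x = 0 := by
    intro x hx v hv
    rw [← hU] at hv
    induction hv using Submodule.span_induction with
    | mem v hv =>
      obtain ⟨i, rfl⟩ := hv
      exact Pi.single_eq_of_ne (fun e => hx ⟨i, e.symm⟩) _
    | zero => rfl
    | add v w _ _ hv hw => simp [hv, hw]
    | smul c v _ hv => simp [hv]
  have hm := sub_mem_swapSpan f L hp
  constructor
  · by_contra hx
    simpa [hne] using key _ hx _ hm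
  · by_contra hx
    simpa [hne.symm] using key _ hx _ hm

lemma IsSwapProd.le [Fintype α] {m : ℕ} {π : Perm α} (hπ : IsSwapProd m π) (hf : Function.Injective f)
    (h : ∀ i : Fin r, π (f i.castSucc) = f i.succ) : r ≤ m := by
  obtain ⟨L, hL, rfl⟩ := hπ
  exact (le_length_of_swapProd hf h).trans hL

end Swaps

section Words

open Equiv

/-- The word `(h₁ h₂)(h₂ h₃)(g₂ g₃)` equals `v` and the word `(g₀ g₁)(h₀ h₁)(g₂ g₃)` equals `w`
for some letters `hᵢ` and `gᵢ`. -/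
def ExistsSwapWords (v w : Perm (Fin 5)) : Prop :=
  ∃ h₁ h₂ h₃ g₂ g₃ : Fin 5, (∀ x, swap h₁ h₂ (swap h₂ h₃ (swap g₂ g₃ x)) = v x) ∧
    ∃ h₀ g₀ g₁ : Fin 5, (h₀ ≠ h₂ ∧ h₀ ≠ h₃) ∧ (g₀ ≠ g₂ ∧ g₀ ≠ g₃ ∧ g₁ ≠ g₂ ∧ g₁ ≠ g₃) ∧
      ∀ x, swap g₀ g₁ (swap h₀ h₁ (swap g₂ g₃ x)) = w x

/-- The 4-cycle `(0 1 2 3)`. -/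
def firstCycle : Perm (Fin 5) := swap 1 2 * swap 2 3 * swap 0 3

/-- The 4-cycle `(0 3 1 4)`. -/
def secondCycle : Perm (Fin 5) := swap 0 1 * swap 1 4 * swap 0 3

set_option maxRecDepth 100000 in
lemma not_existsSwapWords_firstCycle : ¬ ExistsSwapWords firstCycle secondCycle := by
  unfold ExistsSwapWords
  decide

set_option maxRecDepth 100000 in
lemma not_existsSwapWords_secondCycle : ¬ ExistsSwapWords secondCycle firstCycle := by
  unfold ExistsSwapWords
  decide

lemma firstCycle_apply : ∀ i : Fin 3, firstCycle (![0, 1, 2, 3] i.castSucc) =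
    (![0, 1, 2, 3] : Fin 4 → Fin 5) i.succ := by
  decide

lemma secondCycle_apply : ∀ i : Fin 3, secondCycle (![0, 3, 1, 4] i.castSucc) =
    (![0, 3, 1, 4] : Fin 4 → Fin 5) i.succ := by
  decide

lemma secondCycle_mul_firstCycle_inv_apply : ∀ i : Fin 4,
    (secondCycle * firstCycle⁻¹) (![0, 1, 3, 2, 4] i.castSucc) =
      (![0, 1, 3, 2, 4] : Fin 5 → Fin 5) i.succ := by
  decide

variable {α : Type*} [DecidableEq α]

lemma existsSwapWords_of_swapProd_eq [Fintype α] {e : Fin 5 → α} (he : Function.Injective e)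
    {h g : Fin 4 → α} (hh : Function.Injective h) (hg : Function.Injective g)
    {v w : Perm (Fin 5)} {c d : Fin 4 → Fin 5} (hc : Function.Injective c)
    (hd : Function.Injective d) (hv : ∀ i : Fin 3, v (c i.castSucc) = c i.succ)
    (hw : ∀ i : Fin 3, w (d i.castSucc) = d i.succ)
    (h₁ : ∀ x, swapProd [(h 1, h 2), (h 2, h 3), (g 2, g 3)] (e x) = e (v x))
    (h₂ : ∀ x, swapProd [(g 0, g 1), (h 0, h 1), (g 2, g 3)] (e x) = e (w x)) :
    ExistsSwapWords v w := by
  have r₁ {p : α × α} := mem_range_of_swapProd (p := p) (he.comp hc)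
    (fun i => (h₁ _).trans (congrArg e (hv i))) le_rfl
  have r₂ {p : α × α} := mem_range_of_swapProd (p := p) (he.comp hd)
    (fun i => (h₂ _).trans (congrArg e (hw i))) le_rfl
  have hne {i j : Fin 4} (hij : i ≠ j) : h i ≠ h j := hh.ne hij
  have gne {i j : Fin 4} (hij : i ≠ j) : g i ≠ g j := hg.ne hij
  obtain ⟨⟨b₁, e₁⟩, ⟨b₂, e₂⟩⟩ := r₁ (p := (h 1, h 2)) (by simp) (hne (by decide))
  obtain ⟨-, ⟨b₃, e₃⟩⟩ := r₁ (p := (h 2, h 3)) (by simp) (hne (by decide))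
  obtain ⟨⟨c₂, f₂⟩, ⟨c₃, f₃⟩⟩ := r₁ (p := (g 2, g 3)) (by simp) (gne (by decide))
  obtain ⟨⟨c₀, f₀⟩, ⟨c₁, f₁⟩⟩ := r₂ (p := (g 0, g 1)) (by simp) (gne (by decide))
  obtain ⟨⟨b₀, e₀⟩, -⟩ := r₂ (p := (h 0, h 1)) (by simp) (hne (by decide))
  simp only [Function.comp_apply] at e₀ e₁ e₂ e₃ f₀ f₁ f₂ f₃
  have ne_of {x y : Fin 5} {u v : α} (hx : e x = u) (hy : e y = v) (huv : u ≠ v) : x ≠ y := by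
    rintro rfl
    exact huv (hx.symm.trans hy)
  simp only [swapProd, List.map_cons, List.map_nil, List.prod_cons, List.prod_nil, mul_one,
    ← e₀, ← e₁, ← e₂, ← e₃, ← f₀, ← f₁, ← f₂, ← f₃, Perm.mul_apply, he.swap_apply] at h₁ h₂
  exact ⟨_, _, _, _, _, fun x => he (h₁ x), _, _, _,
    ⟨ne_of e₀ e₂ (hne (by decide)), ne_of e₀ e₃ (hne (by decide))⟩,
    ⟨ne_of f₀ f₂ (gne (by decide)), ne_of f₀ f₃ (gne (by decide)),
      ne_of f₁ f₂ (gne (by decide)), ne_of f₁ f₃ (gne (by decide))⟩, fun x => he (h₂ x)⟩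

variable (e : Fin 5 → α)

/-- A transposition, the identity and a 3-cycle sharing one letter with the transposition. -/
def leftTriple : Fin 3 → Perm α :=
  ![swap (e 0) (e 1), 1, swap (e 1) (e 2) * swap (e 2) (e 3)]

/-- Two disjoint transpositions and the identity. -/
def rightTriple : Fin 3 → Perm α := ![swap (e 1) (e 4), swap (e 0) (e 3), 1]

/-- Numbers of transpositions sufficient for the quotients of the entries of `leftTriple`. -/
def leftLength : Fin 3 → Fin 3 → ℕ := ![![0, 1, 3], ![1, 0, 2], ![3, 2, 0]]

/-- Numbers of transpositions sufficient for the quotients of the entries of `rightTriple`. -/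
def rightLength : Fin 3 → Fin 3 → ℕ := ![![0, 2, 1], ![2, 0, 1], ![1, 1, 0]]

lemma isSwapProd_leftTriple (i j : Fin 3) :
    IsSwapProd (leftLength i j) (leftTriple e i * (leftTriple e j)⁻¹) := by
  have h0 : IsSwapProd 0 (1 : Perm α) := ⟨[], le_rfl, rfl⟩
  have h1 (x y : α) : IsSwapProd 1 (swap x y) := ⟨[(x, y)], le_rfl, by simp [swapProd]⟩
  have h2 (x y z w : α) := (h1 x y).mul (h1 z w)
  fin_cases i <;> fin_cases j <;>
    simp [leftLength, leftTriple, h0, h1, h2, ← mul_assoc]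
  · exact (h2 _ _ _ _).mul (h1 _ _)
  · exact (h2 _ _ _ _).mul (h1 _ _)

lemma isSwapProd_rightTriple (i j : Fin 3) :
    IsSwapProd (rightLength i j) ((rightTriple e j)⁻¹ * rightTriple e i) := by
  have h0 : IsSwapProd 0 (1 : Perm α) := ⟨[], le_rfl, rfl⟩
  have h1 (x y : α) : IsSwapProd 1 (swap x y) := ⟨[(x, y)], le_rfl, by simp [swapProd]⟩
  have h2 (x y z w : α) := (h1 x y).mul (h1 z w)
  fin_cases i <;> fin_cases j <;>
    simp [rightLength, rightTriple, h0, h1, h2]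

set_option synthInstance.maxSize 1000 in
lemma eq_of_le_length : ∀ x y z x' y' z' : Fin 3,
    (x' = y' → x' = 2) → (z' = y' → z' = 2) → (x' = z' → x' = 2) →
    4 ≤ rightLength x' z' + leftLength x z → 3 ≤ rightLength z' y' + leftLength z y →
    3 ≤ rightLength x' y' + leftLength x y →
    (x = 0 ∧ y = 1 ∧ z = 2 ∧ z' = 2 ∧ (x' = 0 ∧ y' = 1 ∨ x' = 1 ∧ y' = 0)) ∨
      (x = 2 ∧ y = 1 ∧ z = 0 ∧ x' = 2 ∧ (z' = 0 ∧ y' = 1 ∨ z' = 1 ∧ y' = 0)) := by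
  decide

variable {e}

/-- The quotients of a triple of products of entries of `rightTriple` and `leftTriple` are words
in transpositions. -/
lemma exists_swapProd_eq_quotients (he : Function.Injective e) (γ δ : Perm α) (P : Fin 3 → Perm α)
    (s t : Fin 3 → Fin 3)
    (hquot : ∀ i j, P i * (P j)⁻¹ =
      γ * rightTriple e (s i) * (δ * (leftTriple e (t i) * (leftTriple e (t j))⁻¹) * δ⁻¹) *
        (rightTriple e (s j))⁻¹ * γ⁻¹)
    {a b c : Fin 3} (ha : t a = 0) (hb : t b = 1) (hc : t c = 2) (hc' : s c = 2)
    (hs : s a = 0 ∧ s b = 1 ∨ s a = 1 ∧ s b = 0) :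
    ∃ h g : Fin 4 → α, Function.Injective h ∧ Function.Injective g ∧
      swapProd [(h 1, h 2), (h 2, h 3), (g 2, g 3)] = P c * (P b)⁻¹ ∧
      swapProd [(g 0, g 1), (h 0, h 1), (g 2, g 3)] = P a * (P b)⁻¹ := by
  have hconj (g : Perm α) (x y : α) : swap (g x) (g y) = g * swap x y * g⁻¹ :=
    swap_apply_apply g x y
  have hinj (g : Perm α) : Function.Injective (g ∘ e) := g.injective.comp he
  simp only [hquot]
  rcases hs with ⟨s0, s1⟩ | ⟨s0, s1⟩
  · refine ⟨((γ * δ : Perm α) ∘ e) ∘ ![0, 1, 2, 3], (γ ∘ e) ∘ ![1, 4, 0, 3],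
      (hinj _).comp (by decide), (hinj _).comp (by decide), ?_, ?_⟩ <;>
    simp [swapProd, hconj, ha, hb, hc, hc', s0, s1, leftTriple, rightTriple, mul_assoc]
  · refine ⟨((γ * δ : Perm α) ∘ e) ∘ ![0, 1, 2, 3], (γ ∘ e) ∘ ![0, 3, 1, 4],
      (hinj _).comp (by decide), (hinj _).comp (by decide), ?_, ?_⟩ <;>
    simp [swapProd, hconj, ha, hb, hc, hc', s0, s1, leftTriple, rightTriple, mul_assoc]

/-- The triple of products `leftTriple * rightTriple` cannot be obtained, up to the action of the
diagonal on both sides, by multiplying entries of the two triples in the opposite order. -/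
lemma leftTriple_mul_rightTriple_ne [Fintype α] (he : Function.Injective e) (s t : Fin 3 → Fin 3)
    (hs₂ : ∀ i j, i ≠ j → s i = s j → s i = 2) (γ δ ε : Perm α)
    (h : ∀ i, leftTriple e i * rightTriple e i =
      γ * rightTriple e (s i) * δ * leftTriple e (t i) * ε) : False := by
  set P : Fin 3 → Perm α := fun i => leftTriple e i * rightTriple e i with hP
  have hquot (i j : Fin 3) : P i * (P j)⁻¹ =
      γ * rightTriple e (s i) * (δ * (leftTriple e (t i) * (leftTriple e (t j))⁻¹) * δ⁻¹) *
        (rightTriple e (s j))⁻¹ * γ⁻¹ := by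
    simp only [hP, h]
    group
  have hlen (i j : Fin 3) : IsSwapProd (rightLength (s i) (s j) + leftLength (t i) (t j))
      (P i * (P j)⁻¹) := by
    have := ((isSwapProd_rightTriple e (s i) (s j)).mul
      ((isSwapProd_leftTriple e (t i) (t j)).conj δ)).conj (γ * rightTriple e (s j))
    convert this using 1
    rw [hquot]
    group
  have h21 (x : Fin 5) : (P 2 * (P 1)⁻¹) (e x) = e (firstCycle x) := by
    simp [hP, leftTriple, rightTriple, firstCycle, he.swap_apply]
  have h01 (x : Fin 5) : (P 0 * (P 1)⁻¹) (e x) = e (secondCycle x) := by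
    simp [hP, leftTriple, rightTriple, secondCycle, he.swap_apply]
  have h02 (x : Fin 5) : (P 0 * (P 2)⁻¹) (e x) = e ((secondCycle * firstCycle⁻¹) x) := by
    simp [hP, leftTriple, rightTriple, firstCycle, secondCycle, he.swap_apply]
  have inj₁ : Function.Injective (![0, 1, 2, 3] : Fin 4 → Fin 5) := by decide
  have inj₂ : Function.Injective (![0, 3, 1, 4] : Fin 4 → Fin 5) := by decide
  have inj₃ : Function.Injective (![0, 1, 3, 2, 4] : Fin 5 → Fin 5) := by decide
  have l02 := (hlen 0 2).le (he.comp inj₃)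
    fun i => (h02 _).trans (congrArg e (secondCycle_mul_firstCycle_inv_apply i))
  have l21 := (hlen 2 1).le (he.comp inj₁) fun i => (h21 _).trans (congrArg e (firstCycle_apply i))
  have l01 := (hlen 0 1).le (he.comp inj₂) fun i => (h01 _).trans (congrArg e (secondCycle_apply i))
  rcases eq_of_le_length _ _ _ _ _ _ (hs₂ 0 1 (by decide)) (hs₂ 2 1 (by decide))
    (hs₂ 0 2 (by decide)) l02 l21 l01 with ⟨t0, t1, t2, s2, hs⟩ | ⟨t0, t1, t2, s2, hs⟩
  · obtain ⟨_, _, hh, hg, w₁, w₂⟩ :=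
      exists_swapProd_eq_quotients he γ δ P s t hquot t0 t1 t2 s2 hs
    exact not_existsSwapWords_firstCycle (existsSwapWords_of_swapProd_eq he hh hg inj₁ inj₂
      firstCycle_apply secondCycle_apply (w₁ ▸ h21) (w₂ ▸ h01))
  · obtain ⟨_, _, hh, hg, w₁, w₂⟩ :=
      exists_swapProd_eq_quotients he γ δ P s t hquot t2 t1 t0 s2 hs
    exact not_existsSwapWords_secondCycle (existsSwapWords_of_swapProd_eq he hh hg inj₂ inj₁
      secondCycle_apply firstCycle_apply (w₁ ▸ h01) (w₂ ▸ h21))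

end Words

/-- For `Γ = S_k` with `k ≥ 5` and `n ≥ 3`, the pair `(G_n, K_n)` is not a Gelfand pair. -/
theorem not_gelfandPair_wreath_symmetricGroup (k n : ℕ) (hk : 5 ≤ k) (hn : 3 ≤ n) :
    ¬ IsGelfandPair (Gn (Equiv.Perm (Fin k)) n) (Kn (Equiv.Perm (Fin k)) n) := by
  intro H
  let e : Fin 5 → Fin k := Fin.castLE hk
  let c : Fin n → Fin 3 := fun i => ⟨min i 2, by omega⟩
  obtain ⟨k₁, ⟨γ, h₁⟩, k₂, ⟨δ, h₂⟩, k₃, ⟨ε, h₃⟩, h⟩ :=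
    H.exists_mul_eq ⟨leftTriple e ∘ c, 1⟩ ⟨rightTriple e ∘ c, 1⟩
  have hc (i : Fin 3) : c (Fin.castLE hn i) = i := by
    ext
    simp only [c, Fin.val_castLE]
    omega
  refine leftTriple_mul_rightTriple_ne (e := e) (Fin.castLE_injective hk)
    (fun i => c (k₁.right.symm (Fin.castLE hn i)))
    (fun i => c ((k₁.right * k₂.right).symm (Fin.castLE hn i))) ?_ γ δ ε fun i => ?_
  · intro i j hij he
    by_contra hne
    refine hij (Fin.castLE_injective hn (k₁.right.symm.injective (Fin.ext ?_)))
    simp only [c, Fin.ext_iff] at he hne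
    change ¬ _ = 2 at hne
    omega
  have hl : ∀ j, leftTriple e (c j) * rightTriple e (c j) =
      k₁.left j * rightTriple e (c (k₁.right.symm j)) * k₂.left (k₁.right.symm j) *
        leftTriple e (c ((k₁.right * k₂.right).symm j)) *
        k₃.left ((k₁.right * k₂.right).symm j) :=
    fun j => congrFun (congrArg SemidirectProduct.left h) j
  simpa only [h₁, h₂, h₃, hc] using hl (Fin.castLE hn i)
end
end

section
/- Let Γ = S_4. Then (G_n, K_n) is a Gelfand pair for n ≤ 3 and is not a Gelfand pair for n ≥ 4; that is, the cracking point of S_4 is N(S_4) = 4. -/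
noncomputable section

open Equiv Polynomial

lemma conv_apply {G : Type*} [Group G] [Fintype G] (f g : G → ℂ) (x : G) :
    conv f g x = (Fintype.card G : ℂ)⁻¹ * ∑ z : G, f z * g (z⁻¹ * x) := by
  unfold conv
  congr 1
  exact Fintype.sum_equiv ((Equiv.inv G).trans (Equiv.mulLeft x)) _ _ fun y => by simp

lemma isBiinvariant_conv {G : Type*} [Group G] [Fintype G] {K : Subgroup G} {f g : G → ℂ}
    (hf : IsBiinvariant K f) (hg : IsBiinvariant K g) : IsBiinvariant K (conv f g) := by
  intro k₁ h₁ k₂ h₂ x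
  rw [conv_apply, conv_apply]
  congr 1
  refine (Fintype.sum_equiv (Equiv.mulLeft k₁) _ _ fun z => ?_).symm
  have hfz := hf k₁ h₁ 1 K.one_mem z
  have hgz := hg 1 K.one_mem k₂ h₂ (z⁻¹ * x)
  simp only [mul_one, one_mul] at hfz hgz
  simp only [Equiv.coe_mulLeft, hfz, ← hgz]
  congr 2
  group

/-- Gelfand's trick: if every double coset is closed under inversion, the pair is Gelfand. -/
lemma isGelfandPair_of_inv {G : Type*} [Group G] [Fintype G] {K : Subgroup G}
    (h : ∀ x : G, ∃ k₁ ∈ K, ∃ k₂ ∈ K, x⁻¹ = k₁ * x * k₂) : IsGelfandPair G K := by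
  have inv_eq : ∀ {f : G → ℂ}, IsBiinvariant K f → ∀ x, f x⁻¹ = f x := by
    intro f hf x
    obtain ⟨k₁, h₁, k₂, h₂, hx⟩ := h x
    rw [hx, hf k₁ h₁ k₂ h₂]
  intro f g hf hg
  funext x
  rw [← inv_eq (isBiinvariant_conv hf hg), conv_apply, conv]
  congr 1
  refine Fintype.sum_equiv (Equiv.inv G) _ _ fun z => ?_
  rw [← inv_eq hf z, ← inv_eq hg, mul_comm]
  simp

lemma exists_conj_eq_inv :
    ∀ p q : Perm (Fin 4), ∃ c : Perm (Fin 4), c * p = p⁻¹ * c ∧ c * q = q⁻¹ * c := by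
  decide +kernel

lemma exists_translate_eq_inv {n : ℕ} (h₁ : 1 ≤ n) (h₃ : n ≤ 3) (x : Fin n → Perm (Fin 4)) :
    ∃ a b : Perm (Fin 4), ∃ σ : Perm (Fin n), ∀ i, (x (σ i))⁻¹ = a * x i * b := by
  obtain rfl | rfl | rfl : n = 1 ∨ n = 2 ∨ n = 3 := by omega
  · exact ⟨(x 0)⁻¹, (x 0)⁻¹, 1, fun i => by fin_cases i; simp⟩
  · exact ⟨(x 0)⁻¹, (x 1)⁻¹, Equiv.swap 0 1, fun i => by fin_cases i <;> simp⟩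
  · obtain ⟨c, hp, hq⟩ := exists_conj_eq_inv ((x 0)⁻¹ * x 1) ((x 0)⁻¹ * x 2)
    refine ⟨c * (x 0)⁻¹, c⁻¹ * (x 0)⁻¹, 1, fun i => ?_⟩
    fin_cases i
    · simp
    · change (x 1)⁻¹ = c * (x 0)⁻¹ * x 1 * (c⁻¹ * (x 0)⁻¹)
      rw [mul_assoc c, hp]
      group
    · change (x 2)⁻¹ = c * (x 0)⁻¹ * x 2 * (c⁻¹ * (x 0)⁻¹)
      rw [mul_assoc c, hq]
      group

lemma Gn.mul_left_apply {Γ : Type} [Group Γ] {n : ℕ} (g h : Gn Γ n) (i : Fin n) :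
    (g * h).left i = g.left i * h.left (g.right⁻¹ i) :=
  rfl

lemma Gn.inv_left_apply {Γ : Type} [Group Γ] {n : ℕ} (g : Gn Γ n) (i : Fin n) :
    g⁻¹.left i = (g.left (g.right i))⁻¹ :=
  rfl

lemma isGelfandPair_of_le_three {n : ℕ} (h₁ : 1 ≤ n) (h₃ : n ≤ 3) :
    IsGelfandPair (Gn (Perm (Fin 4)) n) (Kn (Perm (Fin 4)) n) := by
  refine isGelfandPair_of_inv fun g => ?_
  obtain ⟨a, b, σ, h⟩ := exists_translate_eq_inv h₁ h₃ g.left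
  refine ⟨⟨fun _ => a, g.right⁻¹ * σ⟩, ⟨a, rfl⟩,
    ⟨fun _ => b, g.right⁻¹ * σ⁻¹⟩, ⟨b, rfl⟩, ?_⟩
  ext i : 2
  · simpa [Gn.mul_left_apply, Gn.inv_left_apply, -SemidirectProduct.mk_eq_inl_mul_inr] using
      h (σ⁻¹ (g.right i))
  · simp

section NotGelfand

variable {Γ : Type} [Group Γ] [Fintype Γ] {n : ℕ}

/-- The bi-invariant function on `Gn Γ n` obtained by averaging the product function
`φ ⊗ ⋯ ⊗ φ`. -/
def averagedPower (n : ℕ) (φ : Γ → ℂ) (g : Gn Γ n) : ℂ :=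
  ∑ a : Γ, ∑ b : Γ, ∏ i, φ (a * g.left i * b)

lemma isBiinvariant_averagedPower (φ : Γ → ℂ) :
    IsBiinvariant (Kn Γ n) (averagedPower n φ) := by
  rintro ⟨_, σ⟩ ⟨c, rfl⟩ ⟨_, τ⟩ ⟨d, rfl⟩ ⟨x, ρ⟩
  refine Fintype.sum_equiv (Equiv.mulRight c) _ _ fun a => ?_
  refine Fintype.sum_equiv (Equiv.mulLeft d) _ _ fun b => ?_
  refine Fintype.prod_equiv σ.symm _ _ fun i => ?_
  simp [Gn.mul_left_apply, mul_assoc, -SemidirectProduct.mk_eq_inl_mul_inr]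

lemma conv_averagedPower (φ ψ : Γ → ℂ) (x : Fin n → Γ) :
    conv (averagedPower n φ) (averagedPower n ψ) ⟨x, 1⟩ =
      (Fintype.card (Gn Γ n) : ℂ)⁻¹ * (Fintype.card (Perm (Fin n)) *
        ∑ a : Γ, ∑ b : Γ, ∑ a' : Γ, ∑ b' : Γ, ∑ z : Fin n → Γ,
          ∏ i, (φ (a * z i * b) * ψ (a' * ((z i)⁻¹ * x i) * b'))) := by
  rw [conv_apply]
  congr 1
  have key : ∀ p : (Fin n → Γ) × Perm (Fin n),
      averagedPower n ψ ((⟨p.1, p.2⟩ : Gn Γ n)⁻¹ * ⟨x, 1⟩) =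
        ∑ a : Γ, ∑ b : Γ, ∏ i, ψ (a * ((p.1 i)⁻¹ * x i) * b) := by
    rintro ⟨z, σ⟩
    refine Finset.sum_congr rfl fun a _ => Finset.sum_congr rfl fun b _ => ?_
    refine Fintype.prod_equiv σ _ _ fun i => ?_
    simp [Gn.mul_left_apply, Gn.inv_left_apply, -SemidirectProduct.mk_eq_inl_mul_inr]
  rw [Fintype.sum_equiv SemidirectProduct.equivProd _
    (fun p : (Fin n → Γ) × Perm (Fin n) => (∑ a : Γ, ∑ b : Γ, ∏ i, φ (a * p.1 i * b)) *
      ∑ a : Γ, ∑ b : Γ, ∏ i, ψ (a * ((p.1 i)⁻¹ * x i) * b))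
    (fun g => by rw [← key]; rfl), Fintype.sum_prod_type]
  simp only [Finset.sum_const, Finset.card_univ, nsmul_eq_mul, ← Finset.mul_sum]
  congr 1
  simp only [Finset.sum_mul]
  simp only [Finset.mul_sum, ← Finset.prod_mul_distrib]
  rw [Finset.sum_comm]
  refine Finset.sum_congr rfl fun a _ => ?_
  rw [Finset.sum_comm]
  refine Finset.sum_congr rfl fun b _ => ?_
  rw [Finset.sum_comm]
  refine Finset.sum_congr rfl fun a' _ => ?_
  rw [Finset.sum_comm]

/-- Commutativity of convolution on averaged products, tested against a third product function. -/
lemma IsGelfandPair.sum_pow_comm (h : IsGelfandPair (Gn Γ n) (Kn Γ n)) (φ ψ θ : Γ → ℂ) :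
    ∑ a : Γ, ∑ b : Γ, ∑ a' : Γ, ∑ b' : Γ,
        (∑ z : Γ, ∑ w : Γ, φ (a * z * b) * ψ (a' * (z⁻¹ * w) * b') * θ w⁻¹) ^ n =
      ∑ a : Γ, ∑ b : Γ, ∑ a' : Γ, ∑ b' : Γ,
        (∑ z : Γ, ∑ w : Γ, ψ (a * z * b) * φ (a' * (z⁻¹ * w) * b') * θ w⁻¹) ^ n := by
  have expand : ∀ φ ψ : Γ → ℂ, ∑ a : Γ, ∑ b : Γ, ∑ a' : Γ, ∑ b' : Γ,
        (∑ z : Γ, ∑ w : Γ, φ (a * z * b) * ψ (a' * (z⁻¹ * w) * b') * θ w⁻¹) ^ n =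
      ∑ x : Fin n → Γ, (∏ i, θ (x i)⁻¹) *
        ∑ a : Γ, ∑ b : Γ, ∑ a' : Γ, ∑ b' : Γ, ∑ z : Fin n → Γ,
          ∏ i, (φ (a * z i * b) * ψ (a' * ((z i)⁻¹ * x i) * b')) := by
    intro φ ψ
    simp only [Finset.mul_sum]
    conv_rhs => rw [Finset.sum_comm]
    refine Finset.sum_congr rfl fun a _ => ?_
    conv_rhs => rw [Finset.sum_comm]
    refine Finset.sum_congr rfl fun b _ => ?_
    conv_rhs => rw [Finset.sum_comm]
    refine Finset.sum_congr rfl fun a' _ => ?_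
    conv_rhs => rw [Finset.sum_comm]
    refine Finset.sum_congr rfl fun b' _ => ?_
    conv_rhs => rw [Finset.sum_comm]
    simp only [Fintype.sum_pow, Finset.prod_univ_sum, Fintype.piFinset_univ]
    refine Finset.sum_congr rfl fun z _ => Finset.sum_congr rfl fun x _ => ?_
    rw [Finset.prod_mul_distrib, mul_comm]
  rw [expand, expand]
  refine Finset.sum_congr rfl fun x _ => ?_
  refine congrArg (HMul.hMul _) ?_
  have hx := congrFun (h _ _ (isBiinvariant_averagedPower φ) (isBiinvariant_averagedPower ψ)) ⟨x, 1⟩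
  rw [conv_averagedPower, conv_averagedPower] at hx
  have h₁ : (Fintype.card (Gn Γ n) : ℂ)⁻¹ ≠ 0 := by simp
  have h₂ : (Fintype.card (Perm (Fin n)) : ℂ) ≠ 0 := by simp
  exact mul_left_cancel₀ h₂ (mul_left_cancel₀ h₁ hx)

end NotGelfand

section matrixCoeff

variable {R : Type*} [CommRing R]

/-- The matrix coefficient `⟨v, γ w⟩` of the permutation representation. -/
def matrixCoeff (v w : Fin 4 → R) (γ : Perm (Fin 4)) : R :=
  ∑ i, v (γ i) * w i

lemma matrixCoeff_mul_mul (v w : Fin 4 → R) (a γ b : Perm (Fin 4)) :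
    matrixCoeff v w (a * γ * b) = matrixCoeff (v ∘ a) (w ∘ b.symm) γ :=
  Fintype.sum_equiv b _ _ fun i => by simp

lemma sum_perm_apply_mul_apply (u z : Fin 4 → R) (i k : Fin 4) :
    ∑ γ : Perm (Fin 4), u (γ i) * z (γ k) =
      ∑ a, ∑ b, ((8 * (if i = k then 1 else 0) * (if a = b then 1 else 0)
        - 2 * (if i = k then 1 else 0) - 2 * (if a = b then 1 else 0) + 2 : ℤ) : R) *
          (u a * z b) := by
  have count : ∀ i k a b : Fin 4,
      ∑ γ : Perm (Fin 4), (if γ i = a then if γ k = b then (1 : ℤ) else 0 else 0) =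
      8 * (if i = k then 1 else 0) * (if a = b then 1 else 0)
        - 2 * (if i = k then 1 else 0) - 2 * (if a = b then 1 else 0) + 2 := by
    decide +kernel
  simp only [← count, Int.cast_sum, Finset.sum_mul]
  rw [Finset.sum_congr rfl fun a _ => Finset.sum_comm, Finset.sum_comm]
  refine Finset.sum_congr rfl fun γ _ => ?_
  simp

lemma sum_matrixCoeff {v : Fin 4 → R} (hv : ∑ i, v i = 0) (w : Fin 4 → R) :
    ∑ γ, matrixCoeff v w γ = 0 := by
  have h : ∀ i, ∑ γ : Perm (Fin 4), v (γ i) = 0 := by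
    intro i
    have h := sum_perm_apply_mul_apply v 1 i i
    simp only [Pi.one_apply, mul_one] at h
    rw [h, Finset.sum_comm]
    simp [add_mul, sub_mul, Finset.sum_add_distrib, ← Finset.mul_sum, hv]
  simp only [matrixCoeff]
  rw [Finset.sum_comm]
  simp [← Finset.sum_mul, h]

/-- Schur orthogonality for the standard representation. -/
lemma sum_matrixCoeff_mul_matrixCoeff {u v : Fin 4 → R} (hu : ∑ i, u i = 0) (hv : ∑ i, v i = 0)
    (w x : Fin 4 → R) :
    ∑ γ, matrixCoeff u v γ * matrixCoeff x w γ = 8 * (v ⬝ᵥ w) * (u ⬝ᵥ x) := by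
  calc
    _ = ∑ i, ∑ k, (∑ γ : Perm (Fin 4), u (γ i) * x (γ k)) * (v i * w k) := by
      simp only [matrixCoeff, Finset.sum_mul_sum]
      simp only [Finset.sum_mul]
      rw [Finset.sum_comm]
      refine Finset.sum_congr rfl fun i _ => ?_
      rw [Finset.sum_comm]
      exact Finset.sum_congr rfl fun k _ => Finset.sum_congr rfl fun γ _ => by ring
    _ = _ := by
      rw [Fin.sum_univ_four, add_comm, ← eq_neg_iff_add_eq_zero] at hu hv
      simp only [sum_perm_apply_mul_apply, dotProduct, Fin.sum_univ_four, Fin.reduceEq, if_true,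
        if_false]
      push_cast
      rw [hu, hv]
      ring

lemma sum_affine_matrixCoeff_mul {u v w : Fin 4 → R} (hu : ∑ i, u i = 0) (hv : ∑ i, v i = 0)
    (hw : ∑ i, w i = 0) (x : Fin 4 → R) (c d k : R) (y : Perm (Fin 4)) :
    ∑ γ, (c + k * matrixCoeff u v γ) * (d + matrixCoeff w x (γ⁻¹ * y)) =
      24 * (c * d) + 8 * k * (v ⬝ᵥ w) * matrixCoeff u x y := by
  have h₁ : ∑ γ, matrixCoeff w x (γ⁻¹ * y) = 0 := by
    rw [← sum_matrixCoeff hw x]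
    exact Fintype.sum_equiv ((Equiv.inv _).trans (Equiv.mulRight y)) _ _ fun γ => by simp
  have h₂ : ∑ γ, matrixCoeff u v γ * matrixCoeff w x (γ⁻¹ * y) =
      8 * (v ⬝ᵥ w) * matrixCoeff u x y := by
    have : ∀ γ : Perm (Fin 4), matrixCoeff w x (γ⁻¹ * y) = matrixCoeff (x ∘ y.symm) w γ := fun γ =>
      Fintype.sum_equiv (y.trans γ⁻¹) _ _ fun i => by simp [mul_comm]
    simp only [this]
    rw [sum_matrixCoeff_mul_matrixCoeff hu hv]
    congr 1
    exact Fintype.sum_equiv y.symm _ _ fun i => by simp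
  calc
    _ = ∑ γ : Perm (Fin 4), c * d + c * (∑ γ, matrixCoeff w x (γ⁻¹ * y)) +
          k * d * (∑ γ, matrixCoeff u v γ) + k * ∑ γ, matrixCoeff u v γ * matrixCoeff w x (γ⁻¹ * y) := by
      simp only [Finset.mul_sum, ← Finset.sum_add_distrib]
      exact Finset.sum_congr rfl fun γ _ => by ring
    _ = _ := by
      rw [h₁, h₂, sum_matrixCoeff hu]
      simp [Fintype.card_perm, Nat.factorial]
      ring

lemma sum_sum_affine_matrixCoeff {u v w x y z : Fin 4 → R} (hu : ∑ i, u i = 0)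
    (hv : ∑ i, v i = 0) (hw : ∑ i, w i = 0) (hx : ∑ i, x i = 0) (hy : ∑ i, y i = 0)
    (c : R) (a b a' b' : Perm (Fin 4)) :
    ∑ γ, ∑ δ, (1 + matrixCoeff u v (a * γ * b)) *
        (1 + matrixCoeff w x (a' * (γ⁻¹ * δ) * b')) * (c + matrixCoeff y z δ⁻¹) =
      576 * c + 64 * (matrixCoeff w v (a' * b) * matrixCoeff u z a * matrixCoeff y x b') := by
  have comp : ∀ {v : Fin 4 → R} (σ : Perm (Fin 4)), ∑ i, v i = 0 → ∑ i, (v ∘ σ) i = 0 :=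
    fun σ h => (Equiv.sum_comp σ _).trans h
  rw [Finset.sum_comm]
  have h₁ := sum_affine_matrixCoeff_mul (comp a hu) (comp b.symm hv) (comp a' hw) (x ∘ b'.symm) 1 1 1
  have h₂ := sum_affine_matrixCoeff_mul (comp a hu) (comp b'.symm hx) hy z 24 c
    (8 * ((v ∘ b.symm) ⬝ᵥ (w ∘ a'))) 1
  simp only [one_mul, mul_one] at h₁ h₂
  simp only [matrixCoeff_mul_mul, ← Finset.sum_mul, h₁, h₂]
  have e₁ : (v ∘ b.symm) ⬝ᵥ (w ∘ a') = matrixCoeff w v (a' * b) :=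
    Fintype.sum_equiv b.symm _ _ fun i => by simp [mul_comm]
  have e₂ : (x ∘ b'.symm) ⬝ᵥ y = matrixCoeff y x b' :=
    Fintype.sum_equiv b'.symm _ _ fun i => by simp [mul_comm]
  have e₃ : matrixCoeff (u ∘ a) z 1 = matrixCoeff u z a := rfl
  rw [e₁, e₂, e₃]
  ring

end matrixCoeff

/-- Power sums are determined by the polynomial function `c ↦ ∑ q, (c + s q) ^ n`. -/
lemma sum_pow_eq_of_sum_add_pow_eq {ι K : Type*} [Fintype ι] [Field K] [CharZero K] {s t : ι → K}
    {n : ℕ} (h : ∀ c, ∑ q, (c + s q) ^ n = ∑ q, (c + t q) ^ n) {k : ℕ} (hk : k ≤ n) :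
    ∑ q, s q ^ k = ∑ q, t q ^ k := by
  have hP : ∑ q, (X + C (s q)) ^ n = ∑ q, (X + C (t q)) ^ n :=
    Polynomial.funext fun c => by simpa [eval_finsetSum] using h c
  have hc := congrArg (fun P => P.coeff (n - k)) hP
  simp only [finsetSum_coeff, coeff_X_add_C_pow, Nat.sub_sub_self hk, ← Finset.sum_mul] at hc
  exact mul_right_cancel₀ (Nat.cast_ne_zero.2 (Nat.choose_pos (Nat.sub_le n k)).ne') hc

/-- In a Gelfand pair, the degree `k` invariant kernels `(v, w) ↦ ∑ γ, ⟨v, γ w⟩ ^ k` satisfy an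
exchange relation, which fails when there are two independent invariants of degree `k`. -/
lemma IsGelfandPair.sum_matrixCoeff_pow_comm {n : ℕ}
    (h : IsGelfandPair (Gn (Perm (Fin 4)) n) (Kn (Perm (Fin 4)) n)) {k : ℕ} (hk : k ≤ n)
    {u v w x y : Fin 4 → ℂ} (z : Fin 4 → ℂ) (hu : ∑ i, u i = 0)
    (hv : ∑ i, v i = 0) (hw : ∑ i, w i = 0) (hx : ∑ i, x i = 0) (hy : ∑ i, y i = 0) :
    (∑ γ, matrixCoeff w v γ ^ k) * (∑ γ, matrixCoeff u z γ ^ k) * ∑ γ, matrixCoeff y x γ ^ k =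
      (∑ γ, matrixCoeff u x γ ^ k) * (∑ γ, matrixCoeff w z γ ^ k) *
        ∑ γ, matrixCoeff y v γ ^ k := by
  let ι := Perm (Fin 4) × Perm (Fin 4) × Perm (Fin 4) × Perm (Fin 4)
  have factor : ∀ u v w x : Fin 4 → ℂ,
      ∑ q : ι, (64 * (matrixCoeff w v (q.2.2.1 * q.2.1) * matrixCoeff u z q.1 *
          matrixCoeff y x q.2.2.2)) ^ k =
        (64 ^ k * 24) * ((∑ γ, matrixCoeff w v γ ^ k) * (∑ γ, matrixCoeff u z γ ^ k) *
          ∑ γ, matrixCoeff y x γ ^ k) := by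
    intro u v w x
    have translate : ∀ b : Perm (Fin 4), ∑ a, matrixCoeff w v (a * b) ^ k =
        ∑ a, matrixCoeff w v a ^ k :=
      fun b => Fintype.sum_equiv (Equiv.mulRight b) _ _ fun a => rfl
    simp only [ι, Fintype.sum_prod_type, mul_pow, ← Finset.mul_sum, ← Finset.sum_mul, translate]
    simp [Fintype.card_perm, Nat.factorial]
    ring
  have key := sum_pow_eq_of_sum_add_pow_eq (fun c => ?_) hk (ι := ι)
    (s := fun q => 64 * (matrixCoeff w v (q.2.2.1 * q.2.1) * matrixCoeff u z q.1 *
      matrixCoeff y x q.2.2.2))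
    (t := fun q => 64 * (matrixCoeff u x (q.2.2.1 * q.2.1) * matrixCoeff w z q.1 *
      matrixCoeff y v q.2.2.2))
  · rw [factor, factor] at key
    exact mul_left_cancel₀ (by simp) key
  · have hc := h.sum_pow_comm (fun γ => 1 + matrixCoeff u v γ) (fun γ => 1 + matrixCoeff w x γ)
      (fun γ => c / 576 + matrixCoeff y z γ)
    simp only [sum_sum_affine_matrixCoeff hu hv hw hx hy, sum_sum_affine_matrixCoeff hw hx hu hv hy,
      mul_div_cancel₀ c (by norm_num : (576 : ℂ) ≠ 0)] at hc
    simpa only [ι, Fintype.sum_prod_type] using hc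

lemma not_isGelfandPair_of_four_le {n : ℕ} (hn : 4 ≤ n) :
    ¬ IsGelfandPair (Gn (Perm (Fin 4)) n) (Kn (Perm (Fin 4)) n) := by
  intro h
  have cast : ∀ v w : Fin 4 → ℤ, ∑ γ, matrixCoeff (fun i => (v i : ℂ)) (fun i => (w i : ℂ)) γ ^ 4 =
      ((∑ γ, matrixCoeff v w γ ^ 4 : ℤ) : ℂ) := by
    intro v w
    simp [matrixCoeff]
  have hp : ∑ i, ((![1, 1, -1, -1] : Fin 4 → ℤ) i : ℂ) = 0 := by simp [Fin.sum_univ_four]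
  have hq : ∑ i, ((![1, 0, 0, -1] : Fin 4 → ℤ) i : ℂ) = 0 := by simp [Fin.sum_univ_four]
  have key := h.sum_matrixCoeff_pow_comm hn (fun i => ((![1, 0, 0, -1] : Fin 4 → ℤ) i : ℂ))
    hq hp hp hp hp
  simp only [cast] at key
  norm_cast at key

/-- The cracking point of `S_4` is `4`: for `Γ = S_4`, the pair `(G_n, K_n)` is a Gelfand
pair for `1 ≤ n ≤ 3` and is not a Gelfand pair for `n ≥ 4`. -/
theorem crackingPoint_symmetricGroup_four (n : ℕ) :
    (1 ≤ n → n ≤ 3 → IsGelfandPair (Gn (Equiv.Perm (Fin 4)) n) (Kn (Equiv.Perm (Fin 4)) n)) ∧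
    (4 ≤ n → ¬ IsGelfandPair (Gn (Equiv.Perm (Fin 4)) n) (Kn (Equiv.Perm (Fin 4)) n)) :=
  ⟨isGelfandPair_of_le_three, not_isGelfandPair_of_four_le⟩
end
end

section
/- Let Γ = S_3. Then (G_n, K_n) is a Gelfand pair for n ≤ 5 and is not a Gelfand pair for n ≥ 6; that is, the cracking point of S_3 is N(S_3) = 6. -/
noncomputable section

open Equiv Finset

section Gelfand

variable {G : Type*} [Group G] [Fintype G] {K : Subgroup G}

/-- Gelfand's criterion for a pair in which every element lies in the double coset of
its inverse. -/
theorem isGelfandPair_of_inv_mem (h : ∀ x : G, ∃ k₁ ∈ K, ∃ k₂ ∈ K, x⁻¹ = k₁ * x * k₂) :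
    IsGelfandPair G K := by
  intro f g hf hg
  have inv_apply : ∀ {f : G → ℂ}, IsBiinvariant K f → ∀ x, f x⁻¹ = f x := by
    intro f hf x
    obtain ⟨k₁, h₁, k₂, h₂, e⟩ := h x
    rw [e, hf k₁ h₁ k₂ h₂]
  have hconv : IsBiinvariant K (conv f g) := by
    intro k₁ h₁ k₂ h₂ x
    unfold conv
    congr 1
    refine Fintype.sum_equiv (Equiv.mulRight k₂⁻¹) _ _ fun y => ?_
    have e₁ : f (k₁ * x * k₂ * y⁻¹) = f (x * (y * k₂⁻¹)⁻¹) := by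
      rw [← hf k₁ h₁ 1 K.one_mem (x * (y * k₂⁻¹)⁻¹)]
      congr 1
      group
    have e₂ : g (y * k₂⁻¹) = g y := by
      simpa using hg 1 K.one_mem k₂⁻¹ (K.inv_mem h₂) y
    rw [e₁, Equiv.coe_mulRight, e₂]
  funext x
  rw [← inv_apply hconv x]
  unfold conv
  congr 1
  refine Fintype.sum_equiv (Equiv.mulRight x) _ _ fun y => ?_
  rw [Equiv.coe_mulRight, ← inv_apply hf (x⁻¹ * y⁻¹), ← inv_apply hg (x * (y * x)⁻¹)]
  simp [mul_comm]

/-- A bi-invariant function taking opposite signs on `x K u` and `u K x` obstructs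
commutativity of the algebra of bi-invariant functions. -/
theorem not_isGelfandPair_of_sign (F : G → ℤ)
    (hF : ∀ k₁ ∈ K, ∀ k₂ ∈ K, ∀ x : G, F (k₁ * x * k₂) = F x) (x u : G)
    (hnonneg : ∀ k ∈ K, 0 ≤ F (x * k * u)) (hpos : 0 < F (x * u))
    (hnonpos : ∀ k ∈ K, F (u * k * x) ≤ 0) : ¬ IsGelfandPair G K := by
  classical
  intro H
  let D : G → Prop := fun y => ∃ k₁ ∈ K, ∃ k₂ ∈ K, y = k₁ * u⁻¹ * k₂
  let g : G → ℤ := fun y => if D y then 1 else 0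
  have hg : ∀ k₁ ∈ K, ∀ k₂ ∈ K, ∀ y : G, g (k₁ * y * k₂) = g y := by
    intro k₁ h₁ k₂ h₂ y
    have : D (k₁ * y * k₂) ↔ D y := by
      constructor
      · rintro ⟨a, ha, b, hb, e⟩
        refine ⟨k₁⁻¹ * a, K.mul_mem (K.inv_mem h₁) ha, b * k₂⁻¹,
          K.mul_mem hb (K.inv_mem h₂), ?_⟩
        rw [show k₁⁻¹ * a * u⁻¹ * (b * k₂⁻¹) = k₁⁻¹ * (a * u⁻¹ * b) * k₂⁻¹ by group, ← e]
        group
      · rintro ⟨a, ha, b, hb, rfl⟩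
        exact ⟨k₁ * a, K.mul_mem h₁ ha, b * k₂, K.mul_mem hb h₂, by group⟩
    simp only [g, this]
  have key := congrFun (H (fun y => (F y : ℂ)) (fun y => (g y : ℂ))
    (fun k₁ h₁ k₂ h₂ y => by simp only [hF k₁ h₁ k₂ h₂ y])
    (fun k₁ h₁ k₂ h₂ y => by simp only [hg k₁ h₁ k₂ h₂ y])) x
  have hcard : ((Fintype.card G : ℂ))⁻¹ ≠ 0 :=
    inv_ne_zero (Nat.cast_ne_zero.mpr Fintype.card_ne_zero)
  have key' : ∑ y, F (x * y⁻¹) * g y = ∑ y, g (x * y⁻¹) * F y := by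
    have := mul_left_cancel₀ hcard key
    beta_reduce at this
    exact_mod_cast this
  have hlt : 0 < ∑ y, F (x * y⁻¹) * g y := by
    refine Finset.sum_pos' (fun y _ => ?_) ⟨u⁻¹, mem_univ _, ?_⟩
    · by_cases hy : D y
      · obtain ⟨a, ha, b, hb, rfl⟩ := id hy
        have e : F (x * (a * u⁻¹ * b)⁻¹) = F (x * b⁻¹ * u) := by
          rw [← hF 1 K.one_mem a⁻¹ (K.inv_mem ha) (x * b⁻¹ * u)]
          congr 1
          group
        rw [e]
        exact mul_nonneg (hnonneg _ (K.inv_mem hb)) (by dsimp only [g]; split_ifs; all_goals decide)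
      · simp [g, hy]
    · have : D u⁻¹ := ⟨1, K.one_mem, 1, K.one_mem, by simp⟩
      simpa [g, this] using hpos
  have hle : ∑ y, g (x * y⁻¹) * F y ≤ 0 := by
    refine Finset.sum_nonpos fun y _ => ?_
    by_cases hy : D (x * y⁻¹)
    · obtain ⟨a, ha, b, hb, e⟩ := id hy
      have e' : y = b⁻¹ * (u * a⁻¹ * x) * 1 := by
        rw [← inv_inj, ← mul_right_inj x, e]
        group
      have : F y ≤ 0 := by
        rw [e', hF _ (K.inv_mem hb) 1 K.one_mem]
        exact hnonpos _ (K.inv_mem ha)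
      simpa [g, hy] using this
    · simp [g, hy]
  omega

end Gelfand

section Wreath

variable {Γ : Type} [Group Γ] {n : ℕ}

theorem left_mul_mul_apply (x : Gn Γ n) (a b : Γ) (σ τ : Perm (Fin n)) (i : Fin n) :
    ((⟨fun _ => a, σ⟩ : Gn Γ n) * x * ⟨fun _ => b, τ⟩).left i = a * x.left (σ.symm i) * b :=
  rfl

end Wreath

section Count

variable {Γ : Type} [DecidableEq Γ] {n : ℕ}

/-- The number of indices at which a tuple takes a given value. -/
def valueCount (v : Fin n → Γ) (g : Γ) : ℤ := ∑ i, if v i = g then 1 else 0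

theorem valueCount_comp_perm (v : Fin n → Γ) (σ : Perm (Fin n)) :
    valueCount (fun i => v (σ i)) = valueCount v := by
  funext g
  exact Equiv.sum_comp σ fun i => if v i = g then (1 : ℤ) else 0

theorem valueCount_nonneg (v : Fin n → Γ) (g : Γ) : 0 ≤ valueCount v g :=
  Finset.sum_nonneg fun i _ => by split_ifs <;> simp

theorem sum_valueCount [Fintype Γ] (v : Fin n → Γ) : ∑ g, valueCount v g = n := by
  simp only [valueCount]
  rw [Finset.sum_comm]
  simp

theorem exists_perm_of_valueCount_eq {v w : Fin n → Γ} (h : valueCount v = valueCount w) :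
    ∃ σ : Perm (Fin n), v = w ∘ σ := by
  have e : ∀ g, Nonempty ({i // v i = g} ≃ {i // w i = g}) := fun g => by
    rw [← Fintype.card_eq, Fintype.card_subtype, Fintype.card_subtype]
    simpa only [valueCount, Finset.sum_boole, Nat.cast_inj] using congrFun h g
  let e g := (e g).some
  exact ⟨Equiv.ofFiberEquiv e, funext fun i => (Equiv.ofFiberEquiv_map e i).symm⟩

theorem valueCount_of_eq_off_pair {v w : Fin n → Γ} {i j : Fin n} (hij : i ≠ j)
    (h : ∀ l, l ≠ i → l ≠ j → w l = v l) (g : Γ) :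
    valueCount w g = valueCount v g - (if v i = g then 1 else 0) - (if v j = g then 1 else 0)
      + (if w i = g then 1 else 0) + (if w j = g then 1 else 0) := by
  have : ∑ l, ((if w l = g then (1 : ℤ) else 0) - if v l = g then 1 else 0)
      = ∑ l ∈ {i, j}, ((if w l = g then (1 : ℤ) else 0) - if v l = g then 1 else 0) := by
    refine (Finset.sum_subset (Finset.subset_univ _) fun l _ hl => ?_).symm
    simp only [mem_insert, mem_singleton, not_or] at hl
    rw [h l hl.1 hl.2, sub_self]
  rw [Finset.sum_sub_distrib, Finset.sum_pair hij] at this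
  simp only [valueCount]
  linarith

variable [Group Γ]

theorem valueCount_mul_mul (v : Fin n → Γ) (a b : Γ) :
    valueCount (fun i => a * v i * b) = fun g => valueCount v (a⁻¹ * g * b⁻¹) := by
  funext g
  refine Finset.sum_congr rfl fun i _ => ?_
  have : a * v i * b = g ↔ v i = a⁻¹ * g * b⁻¹ := by
    constructor
    · rintro rfl
      group
    · intro h
      rw [h]
      group
  simp only [this]

theorem valueCount_inv (v : Fin n → Γ) :
    valueCount (fun i => (v i)⁻¹) = fun g => valueCount v g⁻¹ := by
  funext g
  exact Finset.sum_congr rfl fun i _ => by simp only [inv_eq_iff_eq_inv]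

/-- `(G_n, K_n)` is a Gelfand pair if every value distribution on `Γ` of total size `n` agrees
with its image under inversion up to left and right translation. -/
theorem isGelfandPair_of_valueCount
    (h : ∀ v : Fin n → Γ, ∃ a b : Γ, ∀ g, valueCount v g⁻¹ = valueCount v (a * g * b))
    [Fintype Γ] : IsGelfandPair (Gn Γ n) (Kn Γ n) := by
  refine isGelfandPair_of_inv_mem fun x => ?_
  obtain ⟨a, b, hab⟩ := h x.left
  have : valueCount (fun i => (x.left i)⁻¹) = valueCount (fun i => a⁻¹ * x.left i * b⁻¹) := by
    rw [valueCount_inv, valueCount_mul_mul]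
    funext g
    simpa using hab g
  obtain ⟨σ, hσ⟩ := exists_perm_of_valueCount_eq this
  refine ⟨⟨fun _ => a⁻¹, (σ * x.right)⁻¹⟩, ⟨_, rfl⟩, ⟨fun _ => b⁻¹, x.right⁻¹ * σ⟩, ⟨_, rfl⟩,
    SemidirectProduct.ext (funext fun i => ?_) ?_⟩
  · rw [left_mul_mul_apply]
    exact congrFun hσ (x.right i)
  · simp only [SemidirectProduct.mul_right, SemidirectProduct.inv_right]
    group

end Count

section SymmetricGroup

/-- Translations and inversion of `S₃` realize every transposition of two distinct elements
of the same sign. -/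
theorem exists_mul_mul_eq_swap_inv (p q : Perm (Fin 3)) (hpq : p ≠ q)
    (hsign : Perm.sign p = Perm.sign q) :
    ∃ a b : Perm (Fin 3), ∀ g, a * g * b = swap p q g⁻¹ := by
  revert p q
  set_option synthInstance.maxSize 1000 in
  decide +kernel

/-- The rotation `0 ↦ 1 ↦ 2 ↦ 0`. -/
def rot : Perm (Fin 3) := finRotate 3

/-- The transposition of `0` and `1`. -/
def refl₀ : Perm (Fin 3) := swap 0 1

theorem eq_rot_or_refl (g : Perm (Fin 3)) :
    g = 1 ∨ g = rot ∨ g = rot ^ 2 ∨ g = refl₀ ∨ g = refl₀ * rot ∨ g = refl₀ * rot ^ 2 := by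
  decide +revert

theorem sum_perm_three (m : Perm (Fin 3) → ℤ) :
    ∑ g, m g = m 1 + m rot + m (rot ^ 2) + m refl₀ + m (refl₀ * rot) + m (refl₀ * rot ^ 2) := by
  have : (univ : Finset (Perm (Fin 3))) =
      {1, rot, rot ^ 2, refl₀, refl₀ * rot, refl₀ * rot ^ 2} := by decide
  rw [this]
  repeat rw [Finset.sum_insert (by decide)]
  rw [Finset.sum_singleton]
  ring

theorem exists_sign_eq_of_sum_le_five (m : Perm (Fin 3) → ℤ) (hm : ∀ g, 0 ≤ m g)
    (hsum : ∑ g, m g ≤ 5) :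
    ∃ p q, p ≠ q ∧ Perm.sign p = Perm.sign q ∧ m p = m q := by
  by_contra! H
  have h₁ := H 1 rot (by decide) (by decide)
  have h₂ := H 1 (rot ^ 2) (by decide) (by decide)
  have h₃ := H rot (rot ^ 2) (by decide) (by decide)
  have h₄ := H refl₀ (refl₀ * rot) (by decide) (by decide)
  have h₅ := H refl₀ (refl₀ * rot ^ 2) (by decide) (by decide)
  have h₆ := H (refl₀ * rot) (refl₀ * rot ^ 2) (by decide) (by decide)
  rw [sum_perm_three] at hsum
  have := hm 1
  have := hm rot
  have := hm (rot ^ 2)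
  have := hm refl₀
  have := hm (refl₀ * rot)
  have := hm (refl₀ * rot ^ 2)
  omega

theorem isGelfandPair_of_le_five {n : ℕ} (hn : n ≤ 5) :
    IsGelfandPair (Gn (Perm (Fin 3)) n) (Kn (Perm (Fin 3)) n) := by
  refine isGelfandPair_of_valueCount fun v => ?_
  obtain ⟨p, q, hpq, hsign, h⟩ := exists_sign_eq_of_sum_le_five (valueCount v)
    (valueCount_nonneg v) (by rw [sum_valueCount]; exact_mod_cast hn)
  obtain ⟨a, b, hab⟩ := exists_mul_mul_eq_swap_inv p q hpq hsign
  refine ⟨a, b, fun g => ?_⟩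
  rw [hab]
  by_cases hp : g⁻¹ = p
  · rw [hp, swap_apply_left, h]
  by_cases hq : g⁻¹ = q
  · rw [hq, swap_apply_right, h]
  rw [swap_apply_of_ne_of_ne hp hq]

/-- The product of the Vandermonde polynomials in the values on the rotations and on the
reflections. It is invariant under translations and changes sign under inversion. -/
def chirality (m : Perm (Fin 3) → ℤ) : ℤ :=
  (m 1 - m rot) * (m rot - m (rot ^ 2)) * (m (rot ^ 2) - m 1) *
    ((m refl₀ - m (refl₀ * rot)) * (m (refl₀ * rot) - m (refl₀ * rot ^ 2)) *
      (m (refl₀ * rot ^ 2) - m refl₀))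

theorem chirality_mul_left (m : Perm (Fin 3) → ℤ) (a : Perm (Fin 3)) :
    chirality (fun g => m (a * g)) = chirality m := by
  have hr (m : Perm (Fin 3) → ℤ) : chirality (fun g => m (rot * g)) = chirality m := by
    simp only [chirality]
    rw [mul_one, show rot * rot = rot ^ 2 by decide, show rot * rot ^ 2 = 1 by decide,
      show rot * refl₀ = refl₀ * rot ^ 2 by decide, show rot * (refl₀ * rot) = refl₀ by decide,
      show rot * (refl₀ * rot ^ 2) = refl₀ * rot by decide]
    ring
  have hs (m : Perm (Fin 3) → ℤ) : chirality (fun g => m (refl₀ * g)) = chirality m := by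
    simp only [chirality]
    rw [mul_one, show refl₀ * refl₀ = 1 by decide, show refl₀ * (refl₀ * rot) = rot by decide,
      show refl₀ * (refl₀ * rot ^ 2) = rot ^ 2 by decide]
    ring
  rcases eq_rot_or_refl a with rfl | rfl | rfl | rfl | rfl | rfl
  · simp only [one_mul]
  · exact hr m
  · simp only [pow_two, mul_assoc]
    exact (hr fun g => m (rot * g)).trans (hr m)
  · exact hs m
  · simp only [mul_assoc]
    exact (hr fun g => m (refl₀ * g)).trans (hs m)
  · simp only [pow_two, mul_assoc]
    exact ((hr fun g => m (refl₀ * (rot * g))).trans (hr fun g => m (refl₀ * g))).trans (hs m)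

theorem chirality_mul_right (m : Perm (Fin 3) → ℤ) (b : Perm (Fin 3)) :
    chirality (fun g => m (g * b)) = chirality m := by
  have hr (m : Perm (Fin 3) → ℤ) : chirality (fun g => m (g * rot)) = chirality m := by
    simp only [chirality]
    rw [one_mul, show rot * rot = rot ^ 2 by decide, show rot ^ 2 * rot = 1 by decide,
      show refl₀ * rot * rot = refl₀ * rot ^ 2 by decide,
      show refl₀ * rot ^ 2 * rot = refl₀ by decide]
    ring
  have hs (m : Perm (Fin 3) → ℤ) : chirality (fun g => m (g * refl₀)) = chirality m := by
    simp only [chirality]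
    rw [one_mul, show refl₀ * refl₀ = 1 by decide, show rot * refl₀ = refl₀ * rot ^ 2 by decide,
      show rot ^ 2 * refl₀ = refl₀ * rot by decide, show refl₀ * rot * refl₀ = rot ^ 2 by decide,
      show refl₀ * rot ^ 2 * refl₀ = rot by decide]
    ring
  rcases eq_rot_or_refl b with rfl | rfl | rfl | rfl | rfl | rfl
  · simp only [mul_one]
  · exact hr m
  · simp only [pow_two, ← mul_assoc]
    exact (hr fun g => m (g * rot)).trans (hr m)
  · exact hs m
  · simp only [← mul_assoc]
    exact (hs fun g => m (g * rot)).trans (hr m)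
  · simp only [pow_two, ← mul_assoc]
    exact ((hs fun g => m (g * rot * rot)).trans (hr fun g => m (g * rot))).trans (hr m)

theorem chirality_mul_mul {n : ℕ} (v : Fin n → Perm (Fin 3)) (a b : Perm (Fin 3)) :
    chirality (valueCount fun i => a * v i * b) = chirality (valueCount v) := by
  rw [valueCount_mul_mul]
  exact (chirality_mul_left (fun g => valueCount v (g * b⁻¹)) a⁻¹).trans
    (chirality_mul_right _ _)

/-- The tuple consisting of the three reflections followed by `m + 3` identities. -/
def reflTuple (m : ℕ) : Fin (m + 6) → Perm (Fin 3) :=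
  Fin.cons refl₀ (Fin.cons (refl₀ * rot) (Fin.cons (refl₀ * rot ^ 2) fun _ : Fin (m + 3) => 1))

theorem reflTuple_cases (m : ℕ) (i : Fin (m + 6)) :
    reflTuple m i = 1 ∨ reflTuple m i = refl₀ ∨ reflTuple m i = refl₀ * rot ∨
      reflTuple m i = refl₀ * rot ^ 2 := by
  unfold reflTuple
  refine Fin.cases (by simp) (fun i => ?_) i
  refine Fin.cases (by simp) (fun i => ?_) i
  refine Fin.cases (by simp only [Fin.cons_succ, Fin.cons_zero, or_true]) (fun i => ?_) i
  simp

theorem valueCount_reflTuple (m : ℕ) (g : Perm (Fin 3)) :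
    valueCount (reflTuple m) g = (if refl₀ = g then 1 else 0) + (if refl₀ * rot = g then 1 else 0)
      + (if refl₀ * rot ^ 2 = g then 1 else 0) + (if 1 = g then (m : ℤ) + 3 else 0) := by
  unfold valueCount reflTuple
  rw [Fin.sum_univ_succ, Fin.sum_univ_succ, Fin.sum_univ_succ]
  simp only [Fin.cons_succ, Fin.cons_zero]
  simp [add_assoc]

/-- The tuple with value `ρ` at the indices `i` and `j` and identities elsewhere. -/
def pairTuple {n : ℕ} (i j : Fin n) (ρ : Perm (Fin 3)) (l : Fin n) : Perm (Fin 3) :=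
  if l = i ∨ l = j then ρ else 1

theorem conj_pairTuple {n : ℕ} (i j : Fin n) (ρ a : Perm (Fin 3)) (l : Fin n) :
    a * pairTuple i j ρ l * a⁻¹ = pairTuple i j (a * ρ * a⁻¹) l := by
  unfold pairTuple
  split_ifs <;> simp

theorem pairTuple_comp {n : ℕ} (i j : Fin n) (ρ : Perm (Fin 3)) (σ : Perm (Fin n)) (l : Fin n) :
    pairTuple i j ρ (σ l) = pairTuple (σ.symm i) (σ.symm j) ρ l := by
  simp only [pairTuple, Equiv.eq_symm_apply]

theorem conj_rot (a : Perm (Fin 3)) : a * rot * a⁻¹ = rot ∨ a * rot * a⁻¹ = rot ^ 2 := by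
  decide +revert

theorem valueCount_mul_pairTuple {n : ℕ} (v : Fin n → Perm (Fin 3)) {i j : Fin n} (hij : i ≠ j)
    (ρ g : Perm (Fin 3)) :
    valueCount (fun l => v l * pairTuple i j ρ l) g = valueCount v g
      - (if v i = g then 1 else 0) - (if v j = g then 1 else 0)
      + (if v i * ρ = g then 1 else 0) + (if v j * ρ = g then 1 else 0) := by
  rw [valueCount_of_eq_off_pair (v := v) hij fun l h₁ h₂ => by simp [pairTuple, h₁, h₂]]
  simp only [pairTuple, true_or, or_true, if_true]

theorem valueCount_pairTuple_mul {n : ℕ} (v : Fin n → Perm (Fin 3)) {i j : Fin n} (hij : i ≠ j)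
    (ρ g : Perm (Fin 3)) :
    valueCount (fun l => pairTuple i j ρ l * v l) g = valueCount v g
      - (if v i = g then 1 else 0) - (if v j = g then 1 else 0)
      + (if ρ * v i = g then 1 else 0) + (if ρ * v j = g then 1 else 0) := by
  rw [valueCount_of_eq_off_pair (v := v) hij fun l h₁ h₂ => by simp [pairTuple, h₁, h₂]]
  simp only [pairTuple, true_or, or_true, if_true]

theorem chirality_mul_pairTuple_nonneg (m : ℕ) {i j : Fin (m + 6)} (hij : i ≠ j)
    {ρ : Perm (Fin 3)} (hρ : ρ = rot ∨ ρ = rot ^ 2) :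
    0 ≤ chirality (valueCount fun l => reflTuple m l * pairTuple i j ρ l) := by
  simp only [chirality, valueCount_mul_pairTuple _ hij, valueCount_reflTuple]
  rcases reflTuple_cases m i with hi | hi | hi | hi <;>
  rcases reflTuple_cases m j with hj | hj | hj | hj <;>
  rcases hρ with rfl | rfl <;>
  rw [hi, hj] <;>
  simp +decide <;>
  nlinarith [Int.natCast_nonneg m]

theorem chirality_pairTuple_mul_nonpos (m : ℕ) {i j : Fin (m + 6)} (hij : i ≠ j)
    {ρ : Perm (Fin 3)} (hρ : ρ = rot ∨ ρ = rot ^ 2) :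
    chirality (valueCount fun l => pairTuple i j ρ l * reflTuple m l) ≤ 0 := by
  simp only [chirality, valueCount_pairTuple_mul _ hij, valueCount_reflTuple]
  rcases reflTuple_cases m i with hi | hi | hi | hi <;>
  rcases reflTuple_cases m j with hj | hj | hj | hj <;>
  rcases hρ with rfl | rfl <;>
  rw [hi, hj] <;>
  simp +decide <;>
  nlinarith [Int.natCast_nonneg m]

theorem chirality_mul_pairTuple_pos (m : ℕ) {i j : Fin (m + 6)} (hi : reflTuple m i = refl₀)
    (hj : reflTuple m j = 1) :
    0 < chirality (valueCount fun l => reflTuple m l * pairTuple i j rot l) := by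
  have hij : i ≠ j := by
    rintro rfl
    exact absurd (hi.symm.trans hj) (by decide)
  simp only [chirality, valueCount_mul_pairTuple _ hij, valueCount_reflTuple]
  rw [hi, hj]
  simp +decide
  nlinarith [Int.natCast_nonneg m]

theorem not_isGelfandPair_add_six (m : ℕ) :
    ¬ IsGelfandPair (Gn (Perm (Fin 3)) (m + 6)) (Kn (Perm (Fin 3)) (m + 6)) := by
  let i : Fin (m + 6) := 0
  let j : Fin (m + 6) := Fin.succ (Fin.succ (Fin.succ 0))
  have hi : reflTuple m i = refl₀ := rfl
  have hj : reflTuple m j = 1 := rfl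
  have hij (σ : Perm (Fin (m + 6))) : σ i ≠ σ j :=
    σ.injective.ne (Fin.succ_ne_zero _).symm
  refine not_isGelfandPair_of_sign (fun x => chirality (valueCount x.left)) ?_
    ⟨reflTuple m, 1⟩ ⟨pairTuple i j rot, 1⟩ ?_ (chirality_mul_pairTuple_pos m hi hj) ?_
  · rintro ⟨_, σ⟩ ⟨a, rfl⟩ ⟨_, τ⟩ ⟨b, rfl⟩ x
    change chirality (valueCount fun l => a * x.left (σ.symm l) * b) = _
    rw [valueCount_comp_perm (fun l => a * x.left l * b) σ.symm, chirality_mul_mul]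
  · rintro ⟨_, σ⟩ ⟨a, rfl⟩
    change 0 ≤ chirality (valueCount fun l => reflTuple m l * a * pairTuple i j rot (σ.symm l))
    rw [← chirality_mul_mul _ 1 a⁻¹]
    simp only [one_mul, mul_assoc]
    simp only [← mul_assoc a, conj_pairTuple, pairTuple_comp, symm_symm]
    exact chirality_mul_pairTuple_nonneg m (hij σ) (conj_rot a)
  · rintro ⟨_, σ⟩ ⟨a, rfl⟩
    change chirality (valueCount fun l => pairTuple i j rot l * a * reflTuple m (σ.symm l)) ≤ 0
    rw [← valueCount_comp_perm _ σ, ← chirality_mul_mul _ a⁻¹ 1]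
    have h (l : Fin (m + 6)) : a⁻¹ * (pairTuple i j rot (σ l) * a * reflTuple m l) * 1 =
        pairTuple (σ.symm i) (σ.symm j) (a⁻¹ * rot * a⁻¹⁻¹) l * reflTuple m l := by
      rw [← conj_pairTuple, ← pairTuple_comp]
      group
    simp only [symm_apply_apply, h]
    exact chirality_pairTuple_mul_nonpos m (hij σ.symm) (conj_rot a⁻¹)

end SymmetricGroup

/-- The cracking point of `S_3` is `6`: for `Γ = S_3`, the pair `(G_n, K_n)` is a Gelfand
pair for `1 ≤ n ≤ 5` and is not a Gelfand pair for `n ≥ 6`. -/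
theorem crackingPoint_symmetricGroup_three (n : ℕ) :
    (1 ≤ n → n ≤ 5 → IsGelfandPair (Gn (Equiv.Perm (Fin 3)) n) (Kn (Equiv.Perm (Fin 3)) n)) ∧
    (6 ≤ n → ¬ IsGelfandPair (Gn (Equiv.Perm (Fin 3)) n) (Kn (Equiv.Perm (Fin 3)) n)) := by
  refine ⟨fun _ hn => isGelfandPair_of_le_five hn, fun hn => ?_⟩
  obtain ⟨m, rfl⟩ := Nat.exists_eq_add_of_le' hn
  exact not_isGelfandPair_add_six m
end
end

section
/- Let Γ be a finite group, n ≥ 1, π = π_{ℓ1} ⊗̂ ⋯ ⊗̂ π_{ℓn} an irreducible representation of Γ^n, and ρ an irreducible representation of S_π. Then the inner product a_ρ = ⟨M_π, χ_ρ⟩_{S_π} = (1/|S_π|) Σ_{σ∈S_π} M_π(σ) conj(χ_ρ(σ)) is a nonnegative integer; in fact it equals the dimension of the space of K_π-fixed vectors in the representation (π∘ω) ⊗̂ ρ of Γ^n ⋊ S_π, where K_π = Δ_n ⋊ S_π. -/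
noncomputable section

open CategoryTheory
open scoped TensorProduct MonoidalCategory

/-- The stabilizer `S_π ⊆ S_n` of the labelled family `π_{ℓ1} ⊗̂ ⋯ ⊗̂ π_{ℓn}`, i.e. the
subgroup of permutations fixing the labelling function `ℓ`. -/
def stab {n : ℕ} {S : Type} (ℓ : Fin n → S) : Subgroup (Equiv.Perm (Fin n)) where
  carrier := {σ | ∀ i, ℓ (σ i) = ℓ i}
  one_mem' := fun _ => rfl
  mul_mem' := by
    intro a b ha hb i
    simpa [Equiv.Perm.mul_apply, hb i] using ha (b i)
  inv_mem' := by
    intro a ha i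
    simpa using (ha (a⁻¹ i)).symm

/-- Transport along an equality of labels. -/
def castLEquiv {Γ S : Type} [Group Γ] (π : S → FDRep ℂ Γ) {s t : S} (h : s = t) :
    (π s : Type) ≃ₗ[ℂ] (π t : Type) := by
  subst h; exact LinearEquiv.refl ℂ (π s)

/-- The intertwining operator `ω(σ)` on `V_1 ⊗ ⋯ ⊗ V_n`, sending
`v_1 ⊗ ⋯ ⊗ v_n` to `v_{σ⁻¹(1)} ⊗ ⋯ ⊗ v_{σ⁻¹(n)}`. -/
def permOp {Γ S : Type} [Group Γ] {n : ℕ} (π : S → FDRep ℂ Γ) (ℓ : Fin n → S)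
    (σ : stab ℓ) : (⨂[ℂ] i, (π (ℓ i) : Type)) →ₗ[ℂ] ⨂[ℂ] i, (π (ℓ i) : Type) :=
  ((PiTensorProduct.reindex ℂ (fun i => (π (ℓ i) : Type)) (σ : Equiv.Perm (Fin n))).trans
    (PiTensorProduct.congr fun i =>
      castLEquiv π (((stab ℓ).inv_mem σ.2) i))).toLinearMap

/-- The character `χ_{π∘ω}` of the representation `π ∘ ω` of `Γ^n ⋊ S_π` on
`V_1 ⊗ ⋯ ⊗ V_n`, given by `(g, σ) ↦ trace (π(g) ∘ ω(σ))`. -/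
def chiPiOmega {Γ S : Type} [Group Γ] {n : ℕ} (π : S → FDRep ℂ Γ) (ℓ : Fin n → S)
    (g : Fin n → Γ) (σ : stab ℓ) : ℂ :=
  LinearMap.trace ℂ _
    ((PiTensorProduct.map fun i => (π (ℓ i)).ρ (g i)) ∘ₗ permOp π ℓ σ)

/-- The class function `M_π` on `S_π`:
`M_π(σ) = (1/|Δ_n|) Σ_{δ ∈ Δ_n} χ_{π∘ω}(δ, σ)`, where `Δ_n ≃ Γ` is the diagonal. -/
def Mpi {Γ S : Type} [Group Γ] [Fintype Γ] {n : ℕ} (π : S → FDRep ℂ Γ) (ℓ : Fin n → S)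
    (σ : stab ℓ) : ℂ :=
  (Fintype.card Γ : ℂ)⁻¹ * ∑ γ : Γ, chiPiOmega π ℓ (fun _ => γ) σ

attribute [local instance] Classical.propDecidable

/-- The operator on `(V_1 ⊗ ⋯ ⊗ V_n) ⊗ W` given by the element `(δ_γ, σ)` of
`K_π = Δ_n ⋊ S_π` acting through the representation `(π ∘ ω) ⊗̂ ρ`, where `δ_γ` is the
diagonal element `(γ, …, γ)`. -/
def kPiOp {Γ S : Type} [Group Γ] {n : ℕ} (π : S → FDRep ℂ Γ) (ℓ : Fin n → S)
    (ρ : FDRep ℂ (stab ℓ)) (γ : Γ) (σ : stab ℓ) :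
    ((⨂[ℂ] i, (π (ℓ i) : Type)) ⊗[ℂ] (ρ : Type)) →ₗ[ℂ]
      (⨂[ℂ] i, (π (ℓ i) : Type)) ⊗[ℂ] (ρ : Type) :=
  TensorProduct.map
    ((PiTensorProduct.map fun i => (π (ℓ i)).ρ γ) ∘ₗ permOp π ℓ σ) (ρ.ρ σ)

/-- The space of `K_π`-fixed vectors in the representation `(π ∘ ω) ⊗̂ ρ` of `Γ^n ⋊ S_π`. -/
def kPiFixed {Γ S : Type} [Group Γ] {n : ℕ} (π : S → FDRep ℂ Γ) (ℓ : Fin n → S)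
    (ρ : FDRep ℂ (stab ℓ)) :
    Submodule ℂ ((⨂[ℂ] i, (π (ℓ i) : Type)) ⊗[ℂ] (ρ : Type)) :=
  ⨅ (γ : Γ) (σ : stab ℓ), LinearMap.ker (kPiOp π ℓ ρ γ σ - LinearMap.id)

/-- Every permutation is conjugate to its inverse by a permutation preserving its cycles. -/
theorem Equiv.Perm.exists_sameCycle_conj_eq_inv {α : Type*} (σ : Equiv.Perm α) :
    ∃ τ : Equiv.Perm α, (∀ x, σ.SameCycle x (τ x)) ∧ τ * σ * τ⁻¹ = σ⁻¹ := by
  let base : α → α := fun x => (Quotient.mk (Equiv.Perm.SameCycle.setoid σ) x).out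
  have base_eq : ∀ x y, σ.SameCycle x y → base x = base y := fun x y h =>
    congrArg Quotient.out (Quotient.sound (s := Equiv.Perm.SameCycle.setoid σ) h)
  have base_same : ∀ x, σ.SameCycle (base x) x := fun x =>
    Quotient.exact (s := Equiv.Perm.SameCycle.setoid σ) (Quotient.out_eq _)
  choose k hk using base_same
  let f : α → α := fun x => (σ ^ (-k x)) (base x)
  have f_spec : ∀ x (j : ℤ), (σ ^ j) (base x) = x → f x = (σ ^ (-j)) (base x) := by
    intro x j hj
    have h : (σ ^ j) (base x) = (σ ^ k x) (base x) := by rw [hj, hk]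
    have h' := congrArg (σ ^ (-j - k x)) h
    simp only [← Equiv.Perm.mul_apply, ← zpow_add] at h'
    have e₁ : -j - k x + j = -k x := by ring
    have e₂ : -j - k x + k x = -j := by ring
    rwa [e₁, e₂] at h'
  have f_same : ∀ x, σ.SameCycle x (f x) := fun x =>
    (Equiv.Perm.SameCycle.symm ⟨k x, hk x⟩).trans ⟨-k x, rfl⟩
  have f_invol : ∀ x, f (f x) = x := by
    intro x
    have hb : base (f x) = base x := (base_eq _ _ (f_same x)).symm
    rw [f_spec (f x) (-k x) (by rw [hb]), hb, neg_neg, hk]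
  have f_apply : ∀ x, f (σ x) = σ⁻¹ (f x) := by
    intro x
    have hb : base (σ x) = base x := (base_eq _ _ ⟨1, by simp⟩).symm
    rw [f_spec (σ x) (1 + k x) (by rw [hb, zpow_add, Equiv.Perm.mul_apply, hk, zpow_one]), hb,
      neg_add, zpow_add, Equiv.Perm.mul_apply, zpow_neg_one]
  refine ⟨⟨f, f, f_invol, f_invol⟩, f_same, ?_⟩
  rw [mul_inv_eq_iff_eq_mul]
  exact Equiv.ext f_apply

theorem isConj_inv_stab {n : ℕ} {S : Type} (ℓ : Fin n → S) (σ : stab ℓ) :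
    ∃ τ : stab ℓ, τ * σ * τ⁻¹ = σ⁻¹ := by
  obtain ⟨τ, hτ, h⟩ := Equiv.Perm.exists_sameCycle_conj_eq_inv (σ : Equiv.Perm (Fin n))
  refine ⟨⟨τ, fun i => ?_⟩, Subtype.ext h⟩
  obtain ⟨k, hk⟩ := hτ i
  rw [← hk]
  exact ((stab ℓ).zpow_mem σ.2 k) i

/-- The trace of the inverse of an operator of finite order is the complex conjugate of
its trace. -/
theorem LinearMap.trace_eq_star_trace_of_pow_eq_one {V : Type*} [AddCommGroup V] [Module ℂ V]
    [FiniteDimensional ℂ V] {f g : Module.End ℂ V} {m : ℕ} (hm : m ≠ 0) (hf : f ^ m = 1)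
    (hgf : g * f = 1) : LinearMap.trace ℂ V g = star (LinearMap.trace ℂ V f) := by
  have hss : f.IsSemisimple :=
    Module.End.isSemisimple_of_squarefree_aeval_eq_zero
      (Polynomial.X_pow_sub_one_separable_iff.mpr (Nat.cast_ne_zero.mpr hm)).squarefree
      (by simp [hf])
  have hint : DirectSum.IsInternal f.eigenspace :=
    DirectSum.isInternal_submodule_of_iSupIndep_of_iSup_eq_top f.eigenspaces_iSupIndep
      hss.iSup_eigenspace_eq_top
  have hfin : {μ | f.eigenspace μ ≠ ⊥}.Finite :=
    WellFoundedGT.finite_ne_bot_of_iSupIndep f.eigenspaces_iSupIndep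
  have hgf' : ∀ x, g (f x) = x := fun x => LinearMap.congr_fun hgf x
  have hfμ : ∀ μ, ∀ x ∈ f.eigenspace μ, f x = μ • x := fun μ x hx =>
    Module.End.mem_eigenspace_iff.mp hx
  have hpow : ∀ μ, ∀ x ∈ f.eigenspace μ, x ≠ 0 → μ ^ m = 1 := by
    intro μ x hx hx0
    have h : (f ^ m) x = μ ^ m • x := Module.End.HasEigenvector.pow_apply ⟨hx, hx0⟩ m
    rw [hf, Module.End.one_apply] at h
    exact smul_left_injective ℂ hx0 (by simpa using h.symm)
  have hgμ : ∀ μ, ∀ x ∈ f.eigenspace μ, g x = star μ • x := by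
    intro μ x hx
    by_cases hx0 : x = 0
    · simp [hx0]
    have hnorm : ‖μ‖ = 1 := Complex.norm_eq_one_of_pow_eq_one (hpow μ x hx hx0) hm
    have hμ : star μ * μ = 1 := by
      simpa [hnorm] using Complex.conj_mul' μ
    calc g x = g ((star μ * μ) • x) := by rw [hμ, one_smul]
      _ = star μ • g (f x) := by rw [mul_smul, map_smul, hfμ μ x hx]
      _ = star μ • x := by rw [hgf']
  have hfmap : ∀ μ, Set.MapsTo f (f.eigenspace μ) (f.eigenspace μ) := fun μ x hx => by
    rw [hfμ μ x hx]; exact Submodule.smul_mem _ _ hx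
  have hgmap : ∀ μ, Set.MapsTo g (f.eigenspace μ) (f.eigenspace μ) := fun μ x hx => by
    rw [hgμ μ x hx]; exact Submodule.smul_mem _ _ hx
  rw [LinearMap.trace_eq_sum_trace_restrict' hint hfin hfmap,
    LinearMap.trace_eq_sum_trace_restrict' hint hfin hgmap, star_sum]
  refine Finset.sum_congr rfl fun μ _ => ?_
  have e₁ : f.restrict (hfmap μ) = μ • LinearMap.id :=
    LinearMap.ext fun x => Subtype.ext (hfμ μ x x.2)
  have e₂ : g.restrict (hgmap μ) = star μ • LinearMap.id :=
    LinearMap.ext fun x => Subtype.ext (hgμ μ x x.2)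
  rw [e₁, e₂]
  simp [LinearMap.trace_id]

theorem FDRep.char_inv_eq_star {G : Type} [Group G] [Finite G] (V : FDRep ℂ G) (g : G) :
    V.character g⁻¹ = star (V.character g) :=
  LinearMap.trace_eq_star_trace_of_pow_eq_one (m := Nat.card G) Nat.card_pos.ne'
    (by rw [← map_pow, pow_card_eq_one', map_one])
    (by rw [← map_mul, inv_mul_cancel, map_one])

theorem star_character_stab {n : ℕ} {S : Type} (ℓ : Fin n → S) (ρ : FDRep ℂ (stab ℓ))
    (σ : stab ℓ) : star (ρ.character σ) = ρ.character σ := by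
  obtain ⟨τ, hτ⟩ := isConj_inv_stab ℓ σ
  rw [← FDRep.char_inv_eq_star, ← hτ, FDRep.char_conj]

section Operators

variable {Γ S : Type} [Group Γ] {n : ℕ} (π : S → FDRep ℂ Γ) (ℓ : Fin n → S)

theorem castLEquiv_castLEquiv {s t u : S} (h : s = t) (h' : t = u) (v : (π s : Type)) :
    castLEquiv π h' (castLEquiv π h v) = castLEquiv π (h.trans h') v := by
  subst h; subst h'; rfl

theorem castLEquiv_ρ {s t : S} (h : s = t) (γ : Γ) (v : (π s : Type)) :
    castLEquiv π h ((π s).ρ γ v) = (π t).ρ γ (castLEquiv π h v) := by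
  subst h; rfl

theorem permOp_tprod (σ : stab ℓ) (v : ∀ i, (π (ℓ i) : Type)) :
    permOp π ℓ σ (PiTensorProduct.tprod ℂ v) =
      PiTensorProduct.tprod ℂ fun i =>
        castLEquiv π (((stab ℓ).inv_mem σ.2) i)
          (v ((σ : Equiv.Perm (Fin n))⁻¹ i)) := by
  unfold permOp
  rw [LinearEquiv.coe_coe, LinearEquiv.trans_apply, PiTensorProduct.reindex_tprod]
  exact PiTensorProduct.congr_tprod _ _

theorem permOp_one : permOp π ℓ 1 = LinearMap.id := by
  refine PiTensorProduct.ext (MultilinearMap.ext fun v => ?_)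
  simp only [LinearMap.compMultilinearMap_apply, permOp_tprod, LinearMap.id_coe, id_eq]
  rfl

theorem permOp_mul (σ τ : stab ℓ) :
    permOp π ℓ (σ * τ) = permOp π ℓ σ ∘ₗ permOp π ℓ τ := by
  refine PiTensorProduct.ext (MultilinearMap.ext fun v => ?_)
  simp only [LinearMap.compMultilinearMap_apply, permOp_tprod, LinearMap.comp_apply,
    castLEquiv_castLEquiv]
  rfl

theorem permOp_comp_map (σ : stab ℓ) (γ : Γ) :
    permOp π ℓ σ ∘ₗ (PiTensorProduct.map fun i => (π (ℓ i)).ρ γ) =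
      (PiTensorProduct.map fun i => (π (ℓ i)).ρ γ) ∘ₗ permOp π ℓ σ := by
  refine PiTensorProduct.ext (MultilinearMap.ext fun v => ?_)
  simp only [LinearMap.compMultilinearMap_apply, permOp_tprod, LinearMap.comp_apply,
    PiTensorProduct.map_tprod, castLEquiv_ρ]

/-- The restriction of `(π ∘ ω) ⊗̂ ρ` to `K_π = Δ_n ⋊ S_π ≃ Γ × S_π`. -/
def kPiRep (ρ : FDRep ℂ (stab ℓ)) :
    Representation ℂ (Γ × stab ℓ) ((⨂[ℂ] i, (π (ℓ i) : Type)) ⊗[ℂ] (ρ : Type)) where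
  toFun g := kPiOp π ℓ ρ g.1 g.2
  map_one' := by
    simp only [kPiOp, Prod.fst_one, Prod.snd_one, permOp_one, map_one, PiTensorProduct.map_one]
    exact TensorProduct.map_id
  map_mul' g h := by
    simp only [kPiOp, Prod.fst_mul, Prod.snd_mul, permOp_mul, map_mul, PiTensorProduct.map_mul]
    rw [Module.End.mul_eq_comp, Module.End.mul_eq_comp, Module.End.mul_eq_comp,
      ← TensorProduct.map_comp]
    congr 1
    simp only [LinearMap.comp_assoc]
    rw [← LinearMap.comp_assoc (permOp π ℓ h.2) _ (permOp π ℓ g.2), permOp_comp_map,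
      LinearMap.comp_assoc]

theorem kPiFixed_eq_invariants (ρ : FDRep ℂ (stab ℓ)) :
    kPiFixed π ℓ ρ = (kPiRep π ℓ ρ).invariants := by
  ext x
  simp only [kPiFixed, Submodule.mem_iInf, LinearMap.mem_ker, LinearMap.sub_apply, sub_eq_zero,
    Representation.mem_invariants, Prod.forall]
  rfl

theorem character_kPiRep (ρ : FDRep ℂ (stab ℓ)) (γ : Γ) (σ : stab ℓ) :
    (kPiRep π ℓ ρ).character (γ, σ) = chiPiOmega π ℓ (fun _ => γ) σ * ρ.character σ :=
  LinearMap.trace_tensorProduct' _ _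

end Operators

/-- The coefficient `a_ρ = ⟨M_π, χ_ρ⟩_{S_π}` is a nonnegative integer; in fact it equals the
dimension of the space of `K_π`-fixed vectors in `(π ∘ ω) ⊗̂ ρ`. -/
theorem Mpi_inner_char_eq_finrank_fixed {Γ S : Type} [Group Γ] [Fintype Γ] (n : ℕ) (hn : 1 ≤ n)
    (π : S → FDRep ℂ Γ) (hsimple : ∀ s, Simple (π s))
    (hdistinct : ∀ s t : S, Nonempty (π s ≅ π t) → s = t)
    (ℓ : Fin n → S) (ρ : FDRep ℂ (stab ℓ)) (hρ : Simple ρ) :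
    (∃ m : ℕ, (Fintype.card (stab ℓ) : ℂ)⁻¹ *
        ∑ σ : stab ℓ, Mpi π ℓ σ * star (ρ.character σ) = (m : ℂ)) ∧
      (Fintype.card (stab ℓ) : ℂ)⁻¹ * ∑ σ : stab ℓ, Mpi π ℓ σ * star (ρ.character σ) =
        (Module.finrank ℂ (kPiFixed π ℓ ρ) : ℂ) := by
  rw [and_iff_right_of_imp fun h => ⟨_, h⟩]
  have : Invertible (Nat.card (Γ × stab ℓ) : ℂ) :=
    invertibleOfNonzero (Nat.cast_ne_zero.mpr Nat.card_pos.ne')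
  rw [kPiFixed_eq_invariants, ← Representation.card_inv_mul_sum_char_eq_finrank,
    Fintype.sum_prod_type_right, Nat.card_prod, Nat.card_eq_fintype_card, Nat.card_eq_fintype_card,
    Nat.cast_mul, mul_inv, mul_comm (Fintype.card Γ : ℂ)⁻¹, mul_assoc]
  simp only [star_character_stab, character_kPiRep, Mpi, ← Finset.sum_mul, mul_assoc,
    ← Finset.mul_sum]
end
end
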